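/- arXiv:2511.09191 — 10 statements merged into one kernel-verified Lean document; each statement's English description precedes it below -/
import Mathlib

section
/- Let (P_n) be a sequence of polynomials, where P_n has degree n, only nonpositive real roots, and P_n(1) = 1, so that one can write P_n(z) = \sum_{k=0}^n a_{n,k} z^k = \prod_{j=1}^n (z + \lambda_{n,j})/(1 + \lambda_{n,j}) with \lambda_{n,j} \ge 0 (hence a_{n,k} \ge 0). Suppose there is a sequence c_n \to \infty such that \Psi(z) := \lim_{n\to\infty} (1/c_n) \log P_n(z) exists for every z \in (0,\infty), that \Psi is differentiable on (0,\infty), and that \Phi(z) := z\,\Psi'(z) is strictly increasing on (0,\infty). Set \underline{m} := \lim_{z\to 0^+} \Phi(z), \overline{m} := \lim_{z\to\infty} \Phi(z), and define g(x) := \Psi(\Phi^{-1}(x)) - x \log \Phi^{-1}(x) for x \in (\underline{m}, \overline{m}). Then for every compact interval [a,b] \subset (\underline{m}, \overline{m}): \sup_{k \in \{0,\dots,n\} \cap [a c_n, b c_n]} | (1/c_n) \log a_{n,k} - g(k/c_n) | \to 0 as n \to \infty. -/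
open Filter Real Set MeasureTheory Polynomial

/-- Nonnegativity together with the log-concavity condition `a i * a (j + 1) ≤ a (i + 1) * a j`
for `i ≤ j`, which excludes internal zeros, is preserved under multiplication by
`X + C μ` with `0 ≤ μ`. -/
theorem logConcave_X_add_C_mul {p : ℝ[X]} {μ : ℝ} (hμ : 0 ≤ μ)
    (hp : ∀ i, 0 ≤ p.coeff i)
    (h : ∀ i j, i ≤ j → p.coeff i * p.coeff (j + 1) ≤ p.coeff (i + 1) * p.coeff j) :
    (∀ i, 0 ≤ ((X + C μ) * p).coeff i) ∧
    ∀ i j, i ≤ j → ((X + C μ) * p).coeff i * ((X + C μ) * p).coeff (j + 1) ≤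
      ((X + C μ) * p).coeff (i + 1) * ((X + C μ) * p).coeff j := by
  have h0 : ((X + C μ) * p).coeff 0 = μ * p.coeff 0 := by simp [add_mul]
  have hs : ∀ i, ((X + C μ) * p).coeff (i + 1) = p.coeff i + μ * p.coeff (i + 1) := by
    intro i; simp [add_mul]
  constructor
  · rintro (_ | i)
    · rw [h0]; exact mul_nonneg hμ (hp 0)
    · rw [hs]; exact add_nonneg (hp i) (mul_nonneg hμ (hp _))
  · intro i j hij
    rcases hij.eq_or_lt with rfl | hlt
    · rw [mul_comm]
    obtain ⟨j, rfl⟩ : ∃ j', j = j' + 1 := ⟨j - 1, by omega⟩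
    rcases i with _ | i
    · rw [h0, hs, hs, hs]
      have h1 := h 0 (j + 1) (by omega)
      have h2 := mul_nonneg (hp 0) (hp j)
      have h3 := mul_nonneg hμ (mul_nonneg (hp 1) (hp j))
      have h4 := mul_le_mul_of_nonneg_left h1 (mul_nonneg hμ hμ)
      simp only [zero_add] at *
      nlinarith
    · rw [hs, hs, hs, hs]
      have h1 := h i j (by omega)
      have h2 := mul_le_mul_of_nonneg_left (h (i + 1) (j + 1) (by omega)) (mul_nonneg hμ hμ)
      have h3 : p.coeff i * p.coeff (j + 1 + 1) ≤ p.coeff (i + 1 + 1) * p.coeff j :=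
        (h i (j + 1) (by omega)).trans (h (i + 1) j (by omega))
      have h4 := mul_le_mul_of_nonneg_left h3 hμ
      nlinarith

theorem logConcave_prod_X_add_C {ι : Type*} (s : Finset ι) (l : ι → ℝ) (hl : ∀ i, 0 ≤ l i) :
    (∀ i, 0 ≤ (∏ j ∈ s, (X + C (l j))).coeff i) ∧
    ∀ i j, i ≤ j → (∏ j ∈ s, (X + C (l j))).coeff i * (∏ j ∈ s, (X + C (l j))).coeff (j + 1) ≤
      (∏ j ∈ s, (X + C (l j))).coeff (i + 1) * (∏ j ∈ s, (X + C (l j))).coeff j := by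
  classical
  induction s using Finset.induction_on with
  | empty =>
    simp only [Finset.prod_empty, coeff_one]
    refine ⟨fun i => by split_ifs <;> norm_num, fun i j _ => by simp⟩
  | insert x s hx ih =>
    rw [Finset.prod_insert hx]
    exact logConcave_X_add_C_mul (hl x) ih.1 ih.2

/-- A coefficient strictly between two nonzero ones is the largest term of `p` at some point. -/
theorem exists_maximal_term {a : ℕ → ℝ} (ha : ∀ i, 0 ≤ a i)
    (h : ∀ i j, i ≤ j → a i * a (j + 1) ≤ a (i + 1) * a j) {i k j : ℕ}
    (hik : i < k) (hkj : k < j) (hi : 0 < a i) (hj : 0 < a j) :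
    0 < a k ∧ ∃ z, 0 < z ∧ ∀ l, a l * z ^ l ≤ a k * z ^ k := by
  have hpos : ∀ d, i + d ≤ j → 0 < a (i + d) := by
    intro d
    induction d with
    | zero => intro _; exact hi
    | succ d ih =>
      intro hd
      have hd' := ih (by omega)
      rcases hd.eq_or_lt with he | hlt
      · rw [he]; exact hj
      obtain ⟨j, rfl⟩ : ∃ j', j = j' + 1 := ⟨j - 1, by omega⟩
      have h1 := h (i + d) j (by omega)
      have h2 : 0 < a (i + d + 1) * a j := (mul_pos hd' hj).trans_le h1
      exact pos_of_mul_pos_left h2 (ha j)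
  have hk : 0 < a k := by
    have := hpos (k - i) (by omega)
    rwa [show i + (k - i) = k by omega] at this
  have hk1 : 0 < a (k + 1) := by
    have := hpos (k + 1 - i) (by omega)
    rwa [show i + (k + 1 - i) = k + 1 by omega] at this
  have hz : 0 < a k / a (k + 1) := div_pos hk hk1
  refine ⟨hk, a k / a (k + 1), hz, fun l => ?_⟩
  set z := a k / a (k + 1) with hzdef
  rcases le_total k l with hl | hl
  · induction l, hl using Nat.le_induction with
    | base => exact le_rfl
    | succ l hl ih =>
      refine le_trans ?_ ih
      have h1 : a (l + 1) * z ≤ a l := by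
        rw [hzdef, ← mul_div_assoc, div_le_iff₀ hk1]
        linarith [h k l hl]
      calc a (l + 1) * z ^ (l + 1) = a (l + 1) * z * z ^ l := by ring
        _ ≤ a l * z ^ l := by gcongr
  · induction hl using Nat.decreasingInduction with
    | self => exact le_rfl
    | of_succ l hl ih =>
      refine le_trans ?_ ih
      have h1 : a l ≤ a (l + 1) * z := by
        rw [hzdef, ← mul_div_assoc, le_div_iff₀ hk1]
        exact h l k hl.le
      calc a l * z ^ l ≤ a (l + 1) * z * z ^ l := by gcongr
        _ = a (l + 1) * z ^ (l + 1) := by ring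

theorem coeff_mul_pow_le_eval {p : ℝ[X]} (hp : ∀ i, 0 ≤ p.coeff i) (k : ℕ) {z : ℝ} (hz : 0 < z) :
    p.coeff k * z ^ k ≤ p.eval z := by
  rw [eval_eq_sum_range]
  by_cases hk : k ≤ p.natDegree
  · exact Finset.single_le_sum (f := fun i => p.coeff i * z ^ i)
      (fun i _ => mul_nonneg (hp i) (pow_pos hz i).le) (Finset.mem_range.2 (by omega))
  · rw [coeff_eq_zero_of_natDegree_lt (by omega), zero_mul]
    exact Finset.sum_nonneg fun i _ => mul_nonneg (hp i) (pow_pos hz i).le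

theorem eval_le_eval_of_coeff_nonneg {p : ℝ[X]} (hp : ∀ i, 0 ≤ p.coeff i) {y z : ℝ} (hy : 0 < y)
    (hyz : y ≤ z) : p.eval y ≤ p.eval z := by
  rw [eval_eq_sum_range, eval_eq_sum_range]
  refine Finset.sum_le_sum fun i _ => ?_
  have := hp i
  gcongr

theorem sum_pow_sub_add_pow_sub_le {q : ℝ} (hq : 0 ≤ q) (hq1 : q < 1) (k N : ℕ) :
    ∑ j ∈ Finset.range N, q ^ ((j - k) + (k - j)) ≤ 2 / (1 - q) := by
  have hs := summable_geometric_of_lt_one hq hq1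
  have h1 : ∑ j ∈ Finset.range N with k ≤ j, q ^ ((j - k) + (k - j)) ≤ (1 - q)⁻¹ := by
    rw [← tsum_geometric_of_lt_one hq hq1]
    have : ∑ j ∈ Finset.range N with k ≤ j, q ^ ((j - k) + (k - j)) =
        ∑ m ∈ ((Finset.range N).filter (k ≤ ·)).image (· - k), q ^ m := by
      rw [Finset.sum_image]
      · refine Finset.sum_congr rfl fun j hj => ?_
        have := (Finset.mem_filter.1 hj).2
        congr 1; omega
      · intro x hx y hy hxy
        have := (Finset.mem_filter.1 hx).2
        have := (Finset.mem_filter.1 hy).2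
        simp only at hxy
        omega
    rw [this]
    exact hs.sum_le_tsum _ fun i _ => pow_nonneg hq i
  have h2 : ∑ j ∈ Finset.range N with ¬ k ≤ j, q ^ ((j - k) + (k - j)) ≤ (1 - q)⁻¹ := by
    rw [← tsum_geometric_of_lt_one hq hq1]
    have : ∑ j ∈ Finset.range N with ¬ k ≤ j, q ^ ((j - k) + (k - j)) =
        ∑ m ∈ ((Finset.range N).filter (¬ k ≤ ·)).image (k - ·), q ^ m := by
      rw [Finset.sum_image]
      · refine Finset.sum_congr rfl fun j hj => ?_
        have := (Finset.mem_filter.1 hj).2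
        congr 1; omega
      · intro x hx y hy hxy
        have := (Finset.mem_filter.1 hx).2
        have := (Finset.mem_filter.1 hy).2
        simp only at hxy
        omega
    rw [this]
    exact hs.sum_le_tsum _ fun i _ => pow_nonneg hq i
  rw [← Finset.sum_filter_add_sum_filter_not (Finset.range N) (fun j => k ≤ j)]
  calc _ ≤ (1 - q)⁻¹ + (1 - q)⁻¹ := add_le_add h1 h2
    _ = _ := by ring

theorem eval_le_of_term_bound {p : ℝ[X]} (hp : ∀ i, 0 ≤ p.coeff i) {v w q : ℝ} (hv : 0 < v)
    (hw : 0 < w) (hq : 0 ≤ q) (hq1 : q < 1) (k : ℕ)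
    (h : ∀ j, p.coeff j * v ^ j ≤ (v / w) ^ k * (p.coeff j * w ^ j) +
      p.coeff k * v ^ k * q ^ ((j - k) + (k - j))) :
    p.eval v ≤ (v / w) ^ k * p.eval w * (1 + 2 / (1 - q)) := by
  have hk := coeff_mul_pow_le_eval hp k hw
  have hkv : p.coeff k * v ^ k = (v / w) ^ k * (p.coeff k * w ^ k) := by
    rw [div_pow]; field_simp
  calc p.eval v = ∑ j ∈ Finset.range (p.natDegree + 1), p.coeff j * v ^ j := eval_eq_sum_range _
    _ ≤ ∑ j ∈ Finset.range (p.natDegree + 1), ((v / w) ^ k * (p.coeff j * w ^ j) +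
      p.coeff k * v ^ k * q ^ ((j - k) + (k - j))) := Finset.sum_le_sum fun j _ => h j
    _ = (v / w) ^ k * p.eval w + p.coeff k * v ^ k *
        ∑ j ∈ Finset.range (p.natDegree + 1), q ^ ((j - k) + (k - j)) := by
      rw [Finset.sum_add_distrib, ← Finset.mul_sum, ← Finset.mul_sum, ← eval_eq_sum_range]
    _ ≤ (v / w) ^ k * p.eval w + (v / w) ^ k * p.eval w * (2 / (1 - q)) := by
      refine add_le_add le_rfl (mul_le_mul ?_ (sum_pow_sub_add_pow_sub_le hq hq1 k _)
        (Finset.sum_nonneg fun j _ => pow_nonneg hq _) ?_)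
      · rw [hkv]; gcongr
      · exact mul_nonneg (pow_pos (div_pos hv hw) k).le
          ((mul_nonneg (hp k) (pow_pos hw k).le).trans hk)
    _ = _ := by ring

theorem eval_le_of_terms_le_above {p : ℝ[X]} (hp : ∀ i, 0 ≤ p.coeff i) {w v z : ℝ} (hw : 0 < w)
    (hwv : w < v) (hvz : v < z) (k : ℕ)
    (h : ∀ j, k < j → p.coeff j * z ^ j ≤ p.coeff k * z ^ k) :
    p.eval v ≤ (v / w) ^ k * p.eval w * (1 + 2 / (1 - v / z)) := by
  have hv := hw.trans hwv
  have hz := hv.trans hvz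
  refine eval_le_of_term_bound hp hv hw (div_pos hv hz).le ((div_lt_one hz).2 hvz) k fun j => ?_
  have hck := hp k
  have hcj := hp j
  rcases le_or_gt j k with hj | hj
  · have h1 : p.coeff j * v ^ j ≤ (v / w) ^ k * (p.coeff j * w ^ j) := by
      have : p.coeff j * v ^ j = (v / w) ^ j * (p.coeff j * w ^ j) := by
        rw [div_pow]; field_simp
      rw [this]
      gcongr
      exact (one_le_div hw).2 hwv.le
    have : 0 ≤ p.coeff k * v ^ k * (v / z) ^ (j - k + (k - j)) := by positivity
    linarith
  · have h1 : p.coeff j * v ^ j ≤ p.coeff k * v ^ k * (v / z) ^ (j - k + (k - j)) := by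
      obtain ⟨d, rfl⟩ : ∃ d, j = k + d := ⟨j - k, by omega⟩
      have e : k + d - k + (k - (k + d)) = d := by omega
      rw [e]
      calc p.coeff (k + d) * v ^ (k + d) = (v / z) ^ (k + d) * (p.coeff (k + d) * z ^ (k + d)) := by
            rw [div_pow]; field_simp
        _ ≤ (v / z) ^ (k + d) * (p.coeff k * z ^ k) := by
            gcongr ?_ * ?_
            exact h _ hj
        _ = _ := by rw [pow_add, div_pow, div_pow]; field_simp
    have : 0 ≤ (v / w) ^ k * (p.coeff j * w ^ j) := by positivity
    linarith

theorem eval_le_of_terms_le_below {p : ℝ[X]} (hp : ∀ i, 0 ≤ p.coeff i) {w v z : ℝ} (hz : 0 < z)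
    (hzv : z < v) (hvw : v < w) (k : ℕ)
    (h : ∀ j, j < k → p.coeff j * z ^ j ≤ p.coeff k * z ^ k) :
    p.eval v ≤ (v / w) ^ k * p.eval w * (1 + 2 / (1 - z / v)) := by
  have hv := hz.trans hzv
  have hw := hv.trans hvw
  refine eval_le_of_term_bound hp hv hw (div_pos hz hv).le ((div_lt_one hv).2 hzv) k fun j => ?_
  have hck := hp k
  have hcj := hp j
  rcases le_or_gt k j with hj | hj
  · have h1 : p.coeff j * v ^ j ≤ (v / w) ^ k * (p.coeff j * w ^ j) := by
      have : p.coeff j * v ^ j = (v / w) ^ j * (p.coeff j * w ^ j) := by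
        rw [div_pow]; field_simp
      rw [this]
      gcongr ?_ * _
      exact pow_le_pow_of_le_one (div_pos hv hw).le ((div_le_one hw).2 hvw.le) hj
    have : 0 ≤ p.coeff k * v ^ k * (z / v) ^ (j - k + (k - j)) := by positivity
    linarith
  · have h1 : p.coeff j * v ^ j ≤ p.coeff k * v ^ k * (z / v) ^ (j - k + (k - j)) := by
      obtain ⟨d, rfl⟩ : ∃ d, k = j + d := ⟨k - j, by omega⟩
      have e : j - (j + d) + (j + d - j) = d := by omega
      rw [e]
      calc p.coeff j * v ^ j = (v / z) ^ j * (p.coeff j * z ^ j) := by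
            rw [div_pow]; field_simp
        _ ≤ (v / z) ^ j * (p.coeff (j + d) * z ^ (j + d)) := by
            gcongr ?_ * ?_
            exact h _ hj
        _ = _ := by rw [pow_add, pow_add, div_pow, div_pow]; field_simp
    have : 0 ≤ (v / w) ^ k * (p.coeff j * w ^ j) := by positivity
    linarith

theorem eval_le_of_maximal_term {p : ℝ[X]} (hp : ∀ i, 0 ≤ p.coeff i) {z y : ℝ} (hz : 0 < z)
    (hzy : z < y) {k : ℕ} (h : ∀ j, p.coeff j * z ^ j ≤ p.coeff k * z ^ k) (M : ℕ) :
    p.eval z ≤ M * (p.coeff k * z ^ k) + (z / y) ^ M * p.eval y := by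
  have hy := hz.trans hzy
  have hck := hp k
  have hterm : ∀ j, p.coeff j * z ^ j ≤
      (if j < M then p.coeff k * z ^ k else 0) + (z / y) ^ M * (p.coeff j * y ^ j) := by
    intro j
    have hcj := hp j
    split_ifs with hj
    · have : 0 ≤ (z / y) ^ M * (p.coeff j * y ^ j) := by positivity
      linarith [h j]
    · have : p.coeff j * z ^ j = (z / y) ^ j * (p.coeff j * y ^ j) := by
        rw [div_pow]; field_simp
      rw [this, zero_add]
      gcongr ?_ * _
      exact pow_le_pow_of_le_one (div_pos hz hy).le ((div_le_one hy).2 hzy.le) (not_lt.1 hj)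
  calc p.eval z = ∑ j ∈ Finset.range (p.natDegree + 1), p.coeff j * z ^ j := eval_eq_sum_range _
    _ ≤ ∑ j ∈ Finset.range (p.natDegree + 1), ((if j < M then p.coeff k * z ^ k else 0) +
        (z / y) ^ M * (p.coeff j * y ^ j)) := Finset.sum_le_sum fun j _ => hterm j
    _ = (∑ j ∈ Finset.range (p.natDegree + 1) with j < M, p.coeff k * z ^ k) +
        (z / y) ^ M * p.eval y := by
      rw [Finset.sum_add_distrib, ← Finset.mul_sum, ← eval_eq_sum_range, Finset.sum_filter]
    _ ≤ _ := by
      rw [Finset.sum_const, nsmul_eq_mul]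
      gcongr
      calc _ ≤ (Finset.range M).card := Finset.card_le_card fun j hj =>
            Finset.mem_range.2 (Finset.mem_filter.1 hj).2
        _ = M := Finset.card_range M

/-- Pointwise convergence of monotone functions on `(0, ∞)` to a continuous limit is uniform
on compact subsets. -/
theorem eventually_forall_abs_sub_lt_of_monotoneOn {F : ℕ → ℝ → ℝ} {G : ℝ → ℝ}
    (hF : ∀ᶠ n in atTop, MonotoneOn (F n) (Ioi 0)) (hG : ContinuousOn G (Ioi 0))
    (hlim : ∀ z, 0 < z → Tendsto (fun n => F n z) atTop (nhds (G z)))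
    {K : Set ℝ} (hK : IsCompact K) (hK0 : K ⊆ Ioi 0) {ε : ℝ} (hε : 0 < ε) :
    ∀ᶠ n in atTop, ∀ z ∈ K, |F n z - G z| < ε := by
  refine hK.induction_on (p := fun s => ∀ᶠ n in atTop, ∀ z ∈ s, |F n z - G z| < ε) ?_ ?_ ?_ ?_
  · simp
  · intro s t hst ht
    filter_upwards [ht] with n hn z hz using hn z (hst hz)
  · intro s t hs ht
    filter_upwards [hs, ht] with n h1 h2 z hz
    exact hz.elim (h1 z) (h2 z)
  · intro z hz
    have hz0 : 0 < z := hK0 hz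
    have hcont : ContinuousAt G z := hG.continuousAt (Ioi_mem_nhds hz0)
    obtain ⟨δ, hδ, hball⟩ := Metric.continuousAt_iff.1 hcont (ε / 3) (by positivity)
    set d := min (δ / 2) (z / 2) with hd
    have hd0 : 0 < d := by positivity
    have hdδ : d < δ := (min_le_left _ _).trans_lt (by linarith)
    have hdz : d < z := (min_le_right _ _).trans_lt (by linarith)
    have hnear : ∀ y, |y - z| ≤ d → |G y - G z| < ε / 3 := fun y hy =>
      hball (x := y) (by rw [Real.dist_eq]; exact hy.trans_lt hdδ)
    refine ⟨Ioo (z - d) (z + d), mem_nhdsWithin_of_mem_nhds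
      (Ioo_mem_nhds (by linarith) (by linarith)), ?_⟩
    have e1 := (Metric.tendsto_nhds.1 (hlim (z - d) (by linarith))) (ε / 3) (by positivity)
    have e2 := (Metric.tendsto_nhds.1 (hlim (z + d) (by linarith))) (ε / 3) (by positivity)
    filter_upwards [hF, e1, e2] with n hn h1 h2 y hy
    rw [Real.dist_eq, abs_lt] at h1 h2
    have m1 := hn (a := z - d) (b := y) (show 0 < z - d by linarith)
      (show 0 < y by linarith [hy.1]) hy.1.le
    have m2 := hn (a := y) (b := z + d) (show 0 < y by linarith [hy.1])
      (show 0 < z + d by linarith) hy.2.le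
    have g1 := abs_lt.1 (hnear (z - d) (by rw [abs_le]; constructor <;> linarith))
    have g2 := abs_lt.1 (hnear (z + d) (by rw [abs_le]; constructor <;> linarith))
    have g3 := abs_lt.1 (hnear y (by rw [abs_le]; constructor <;> linarith [hy.1, hy.2]))
    rw [abs_lt]
    constructor <;> linarith [g1.1, g1.2, g2.1, g2.2, g3.1, g3.2, h1.1, h1.2, h2.1, h2.2]

/-- A point `ζ` with `ζ * Ψ' ζ = x` is the strict minimizer of `Ψ z - x * log z`
when `z * Ψ' z` is strictly increasing. -/
theorem sub_mul_log_lt_of_strictMonoOn {Ψ Ψ' : ℝ → ℝ}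
    (hΨ' : ∀ z : ℝ, 0 < z → HasDerivAt Ψ (Ψ' z) z)
    (hmono : StrictMonoOn (fun z => z * Ψ' z) (Ioi 0)) {ζ z : ℝ} (hζ : 0 < ζ) (hz : 0 < z)
    (hne : z ≠ ζ) :
    Ψ ζ - ζ * Ψ' ζ * Real.log ζ < Ψ z - ζ * Ψ' ζ * Real.log z := by
  set x := ζ * Ψ' ζ with hx
  have hd : ∀ y : ℝ, 0 < y →
      HasDerivAt (fun y => Ψ y - x * Real.log y) (Ψ' y - x * y⁻¹) y := fun y hy =>
    (hΨ' y hy).sub ((Real.hasDerivAt_log hy.ne').const_mul x)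
  have hcont : ContinuousOn (fun y => Ψ y - x * Real.log y) (Ioi 0) := fun y hy =>
    (hd y hy).continuousAt.continuousWithinAt
  have hval : ∀ y : ℝ, 0 < y → Ψ' y - x * y⁻¹ = (y * Ψ' y - x) / y := fun y hy => by field_simp
  rcases lt_or_gt_of_ne hne with hlt | hgt
  · have hsub : Icc z ζ ⊆ Ioi 0 := fun y hy => hz.trans_le hy.1
    refine strictAntiOn_of_deriv_neg (convex_Icc z ζ) (hcont.mono hsub) ?_
      (left_mem_Icc.2 hlt.le) (right_mem_Icc.2 hlt.le) hlt
    intro y hy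
    rw [interior_Icc] at hy
    have hy0 : 0 < y := hz.trans hy.1
    rw [(hd y hy0).deriv, hval y hy0]
    exact div_neg_of_neg_of_pos (sub_neg.2 (hmono hy0 hζ hy.2)) hy0
  · have hsub : Icc ζ z ⊆ Ioi 0 := fun y hy => hζ.trans_le hy.1
    refine strictMonoOn_of_deriv_pos (convex_Icc ζ z) (hcont.mono hsub) ?_
      (left_mem_Icc.2 hgt.le) (right_mem_Icc.2 hgt.le) hgt
    intro y hy
    rw [interior_Icc] at hy
    have hy0 : 0 < y := hζ.trans hy.1
    rw [(hd y hy0).deriv, hval y hy0]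
    exact div_pos (sub_pos.2 (hmono hζ hy0 hy.1)) hy0

theorem eventually_not_eval_le {P : ℕ → ℝ[X]} {c : ℕ → ℝ} {Ψ : ℝ → ℝ}
    (hpos : ∀ n z, 0 < z → 0 < (P n).eval z) (hc : Tendsto c atTop atTop)
    (hlim : ∀ z : ℝ, 0 < z →
      Tendsto (fun n => (1 / c n) * Real.log ((P n).eval z)) atTop (nhds (Ψ z)))
    {v w x D : ℝ} (hv : 0 < v) (hw : 0 < w) (hD : 0 < D)
    (h : Ψ w - x * Real.log w < Ψ v - x * Real.log v) :
    ∀ᶠ n in atTop, ∀ k : ℕ, k * Real.log (v / w) ≤ x * c n * Real.log (v / w) →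
      ¬ (P n).eval v ≤ (v / w) ^ k * (P n).eval w * D := by
  have ht := ((hlim v hv).sub (hlim w hw)).sub
    ((tendsto_const_nhds (x := Real.log D)).div_atTop hc)
  have hlt : x * Real.log (v / w) < Ψ v - Ψ w - 0 := by
    rw [Real.log_div hv.ne' hw.ne']; linarith
  filter_upwards [ht.eventually (lt_mem_nhds hlt), hc.eventually_gt_atTop 0] with n hn hcn k hk hle
  have hpw := hpos n w hw
  have hq : 0 < v / w := div_pos hv hw
  have h1 := Real.log_le_log (hpos n v hv) hle
  rw [Real.log_mul (by positivity) hD.ne', Real.log_mul (by positivity) hpw.ne',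
    Real.log_pow] at h1
  have h2 := mul_lt_mul_of_pos_left hn hcn
  have h3 : c n * (1 / c n * Real.log ((P n).eval v) - 1 / c n * Real.log ((P n).eval w) -
      Real.log D / c n) = Real.log ((P n).eval v) - Real.log ((P n).eval w) - Real.log D := by
    field_simp
  rw [h3] at h2
  linarith

theorem eval_pos_and_logConcave_of_eq_prod {n : ℕ} {l : Fin n → ℝ} (hl : ∀ j, 0 ≤ l j) {p : ℝ[X]}
    (hp : p = ∏ j : Fin n, C (1 + l j)⁻¹ * (X + C (l j))) :
    (∀ z, 0 < z → 0 < p.eval z) ∧ (∀ i, 0 ≤ p.coeff i) ∧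
    ∀ i j, i ≤ j → p.coeff i * p.coeff (j + 1) ≤ p.coeff (i + 1) * p.coeff j := by
  have hinv : ∀ j, 0 < (1 + l j)⁻¹ := fun j => inv_pos.2 (by linarith [hl j])
  constructor
  · intro z hz
    rw [hp, eval_prod]
    refine Finset.prod_pos fun j _ => ?_
    simp only [eval_mul, eval_C, eval_add, eval_X]
    exact mul_pos (hinv j) (by linarith [hl j])
  · obtain ⟨h1, h2⟩ := logConcave_prod_X_add_C Finset.univ l hl
    set q := ∏ j : Fin n, (X + C (l j))
    set s := ∏ j : Fin n, (1 + l j)⁻¹ with hs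
    have hs0 : 0 < s := Finset.prod_pos fun j _ => hinv j
    have hpq : p = C s * q := by rw [hp, Finset.prod_mul_distrib, hs, map_prod]
    have hcoeff : ∀ i, p.coeff i = s * q.coeff i := fun i => by rw [hpq, coeff_C_mul]
    refine ⟨fun i => by rw [hcoeff]; exact mul_nonneg hs0.le (h1 i), fun i j hij => ?_⟩
    simp only [hcoeff]
    have := mul_le_mul_of_nonneg_left (h2 i j hij) (mul_pos hs0 hs0).le
    linarith

/-- The maximal term at `z` is comparable to the value at `z` up to a factor polynomial in `c`. -/
theorem log_eval_le_log_coeff_add {p : ℝ[X]} (hp : ∀ i, 0 ≤ p.coeff i) {z y c : ℝ} {k : ℕ}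
    (hz : 0 < z) (hzy : z < y) (hpz : 0 < p.eval z) (hk : 0 < p.coeff k) (hc : 1 ≤ c)
    (h : ∀ j, p.coeff j * z ^ j ≤ p.coeff k * z ^ k)
    (hgrowth : Real.log (p.eval y) - Real.log (p.eval z) + Real.log 2 ≤
      c ^ 2 * Real.log (y / z)) :
    Real.log (p.eval z) ≤ Real.log (p.coeff k) + k * Real.log z + Real.log 4 +
      2 * Real.log c := by
  have hy := hz.trans hzy
  have hpy : 0 < p.eval y := hpz.trans_le (eval_le_eval_of_coeff_nonneg hp hz hzy.le)
  have hlog : 0 < Real.log (y / z) := Real.log_pos ((one_lt_div hz).2 hzy)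
  set M := ⌈c ^ 2⌉₊ with hM
  have hM1 : c ^ 2 ≤ M := Nat.le_ceil _
  have hM2 : (M : ℝ) ≤ 2 * c ^ 2 := by
    have := (Nat.ceil_lt_add_one (sq_nonneg c)).le
    nlinarith
  have hterm : 0 < p.coeff k * z ^ k := mul_pos hk (pow_pos hz k)
  have htail : (z / y) ^ M * p.eval y ≤ p.eval z / 2 := by
    have hzy0 : 0 < z / y := div_pos hz hy
    rw [← Real.log_le_log_iff (by positivity) (by positivity),
      Real.log_mul (by positivity) hpy.ne', Real.log_pow, Real.log_div hpz.ne' two_ne_zero,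
      ← inv_div y z, Real.log_inv]
    have := mul_le_mul_of_nonneg_right hM1 hlog.le
    linarith
  have hmain := eval_le_of_maximal_term hp hz hzy h M
  have h1 : p.eval z ≤ 4 * c ^ 2 * (p.coeff k * z ^ k) := by
    have := mul_le_mul_of_nonneg_right hM2 hterm.le
    linarith
  have h2 := Real.log_le_log hpz h1
  have hc0 : 0 < c := by linarith
  rw [Real.log_mul (by positivity) hterm.ne', Real.log_mul (by norm_num) (by positivity),
    Real.log_pow, Real.log_mul hk.ne' (by positivity), Real.log_pow] at h2
  push_cast at h2
  linarith

theorem lt_of_maximal_term_of_lt {a : ℕ → ℝ} {z y : ℝ} {k j : ℕ} (hz : 0 < z) (hy : 0 < y)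
    (hkj : k < j) (hj : 0 < a j) (hmax : a j * z ^ j ≤ a k * z ^ k)
    (h : a k * y ^ k < a j * y ^ j) : z < y := by
  obtain ⟨d, rfl⟩ : ∃ d, j = k + d := ⟨j - k, by omega⟩
  rw [pow_add, mul_comm (z ^ k), ← mul_assoc, mul_le_mul_iff_left₀ (pow_pos hz k)] at hmax
  rw [pow_add, mul_comm (y ^ k), ← mul_assoc, mul_lt_mul_iff_left₀ (pow_pos hy k)] at h
  exact lt_of_pow_lt_pow_left₀ d hy.le (lt_of_mul_lt_mul_left (hmax.trans_lt h) hj.le)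

theorem lt_of_lt_of_maximal_term {a : ℕ → ℝ} {z y : ℝ} {k i : ℕ} (hz : 0 < z) (hy : 0 < y)
    (hik : i < k) (hk : 0 < a k) (hmax : a i * z ^ i ≤ a k * z ^ k)
    (h : a k * y ^ k < a i * y ^ i) : y < z := by
  obtain ⟨d, rfl⟩ : ∃ d, k = i + d := ⟨k - i, by omega⟩
  rw [pow_add, mul_comm (z ^ i), ← mul_assoc, mul_le_mul_iff_left₀ (pow_pos hz i)] at hmax
  rw [pow_add, mul_comm (y ^ i), ← mul_assoc, mul_lt_mul_iff_left₀ (pow_pos hy i)] at h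
  exact lt_of_pow_lt_pow_left₀ d hz.le (lt_of_mul_lt_mul_left (h.trans_le hmax) hk.le)

/-- **Exponential profile of coefficients.**
For polynomials `P n` of degree `n` with nonpositive real roots and `P n 1 = 1`,
written as `P n z = ∏ j (z + λ_{n,j})/(1 + λ_{n,j})` with `λ_{n,j} ≥ 0`, if
`Ψ z = lim (1/c_n) log P_n z` exists on `(0,∞)`, `Ψ` is differentiable there and
`Φ z = z Ψ'(z)` is strictly increasing on `(0,∞)`, then with
`g x = Ψ(Φ⁻¹ x) - x log Φ⁻¹ x`, uniformly for `k ∈ {0,…,n} ∩ [a c_n, b c_n]` with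
`[a,b] ⊂ (m̲, m̄)`, one has `(1/c_n) log a_{n,k} - g(k/c_n) → 0`. -/
theorem exponential_profile_of_coefficients
    (lam : (n : ℕ) → Fin n → ℝ)
    (hlam : ∀ n j, 0 ≤ lam n j)
    (P : ℕ → Polynomial ℝ)
    (hP : ∀ n, P n = ∏ j : Fin n,
      Polynomial.C (1 + lam n j)⁻¹ * (Polynomial.X + Polynomial.C (lam n j)))
    (c : ℕ → ℝ) (hc : Tendsto c atTop atTop)
    (Ψ Ψ' : ℝ → ℝ)
    (hΨlim : ∀ z : ℝ, 0 < z →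
      Tendsto (fun n => (1 / c n) * Real.log ((P n).eval z)) atTop (nhds (Ψ z)))
    (hΨ' : ∀ z : ℝ, 0 < z → HasDerivAt Ψ (Ψ' z) z)
    (Φ : ℝ → ℝ) (hΦ : ∀ z, Φ z = z * Ψ' z)
    (hΦmono : StrictMonoOn Φ (Set.Ioi 0))
    (mlow mhigh : EReal)
    (hmlow : Tendsto (fun z => ((Φ z : ℝ) : EReal)) (nhdsWithin 0 (Set.Ioi 0)) (nhds mlow))
    (hmhigh : Tendsto (fun z => ((Φ z : ℝ) : EReal)) atTop (nhds mhigh))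
    (Φinv : ℝ → ℝ)
    (hΦinv : ∀ x : ℝ, mlow < (x : EReal) → (x : EReal) < mhigh →
      0 < Φinv x ∧ Φ (Φinv x) = x)
    (g : ℝ → ℝ)
    (hg : ∀ x, g x = Ψ (Φinv x) - x * Real.log (Φinv x))
    (a b : ℝ) (hab : a ≤ b) (ha : mlow < (a : EReal)) (hb : (b : EReal) < mhigh) :
    ∀ ε > 0, ∀ᶠ n in atTop, ∀ k ≤ n,
      a * c n ≤ (k : ℝ) → (k : ℝ) ≤ b * c n →
      |(1 / c n) * Real.log ((P n).coeff k) - g ((k : ℝ) / c n)| < ε := by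
  have hP' := fun n => eval_pos_and_logConcave_of_eq_prod (hlam n) (hP n)
  have hpos : ∀ n z, 0 < z → 0 < (P n).eval z := fun n => (hP' n).1
  have hcoeff : ∀ n i, 0 ≤ (P n).coeff i := fun n => (hP' n).2.1
  obtain rfl : Φ = fun z => z * Ψ' z := funext hΦ
  obtain ⟨hu0, hΦu⟩ := hΦinv a ha ((EReal.coe_le_coe_iff.2 hab).trans_lt hb)
  obtain ⟨hv0, hΦv⟩ := hΦinv b (ha.trans_le (EReal.coe_le_coe_iff.2 hab)) hb
  set u := Φinv a
  set v := Φinv b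
  simp only at hΦu hΦv
  have hcrit : ∀ {ζ z : ℝ}, 0 < ζ → 0 < z → z ≠ ζ →
      Ψ ζ - ζ * Ψ' ζ * Real.log ζ < Ψ z - ζ * Ψ' ζ * Real.log z :=
    fun hζ hz hne => sub_mul_log_lt_of_strictMonoOn hΨ' hΦmono hζ hz hne
  have hinv : ∀ x, a ≤ x → x ≤ b →
      0 < Φinv x ∧ Φinv x * Ψ' (Φinv x) = x ∧ u ≤ Φinv x ∧ Φinv x ≤ v := by
    intro x hax hxb
    obtain ⟨h0, hx⟩ := hΦinv x (ha.trans_le (EReal.coe_le_coe_iff.2 hax))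
      ((EReal.coe_le_coe_iff.2 hxb).trans_lt hb)
    simp only at hx
    refine ⟨h0, hx, (hΦmono.le_iff_le hu0 h0).1 ?_, (hΦmono.le_iff_le h0 hv0).1 ?_⟩
    · simpa only [hΦu, hx] using hax
    · simpa only [hΦv, hx] using hxb
  have huv : u ≤ v := (hinv a le_rfl hab).2.2.2
  have hcont : ContinuousOn Ψ (Ioi 0) := fun z hz =>
    (hΨ' z hz).continuousAt.continuousWithinAt
  have hmonoF : ∀ᶠ n in atTop,
      MonotoneOn (fun z => (1 / c n) * Real.log ((P n).eval z)) (Ioi 0) := by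
    filter_upwards [hc.eventually_gt_atTop 0] with n hcn y hy z hz hyz
    exact mul_le_mul_of_nonneg_left
      (Real.log_le_log (hpos n y hy) (eval_le_eval_of_coeff_nonneg (hcoeff n) hy hyz)) (by positivity)
  intro ε hε
  have hunif := eventually_forall_abs_sub_lt_of_monotoneOn hmonoF hcont hΨlim
    (isCompact_Icc (a := u / 3) (b := 4 * v))
    (fun z hz => (show 0 < u / 3 by positivity).trans_le hz.1)
    (show 0 < min (ε / 3) 1 by positivity)
  have habove := eventually_not_eval_le hpos hc hΨlim (v := 2 * v) (w := v) (x := b)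
    (D := 1 + 2 / (1 - 2 * v / (3 * v))) (by positivity) hv0
    (by
      have : 2 * v / (3 * v) = 2 / 3 := by field_simp
      rw [this]; norm_num)
    (by simpa only [hΦv] using hcrit hv0 (show 0 < 2 * v by positivity) (by linarith))
  have hbelow := eventually_not_eval_le hpos hc hΨlim (v := u / 2) (w := u) (x := a)
    (D := 1 + 2 / (1 - u / 3 / (u / 2))) (by positivity) hu0
    (by
      have : u / 3 / (u / 2) = 2 / 3 := by field_simp
      rw [this]; norm_num)
    (by simpa only [hΦu] using hcrit hu0 (show 0 < u / 2 by positivity) (by linarith))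
  have hlogc : Tendsto (fun n => Real.log 4 / c n + 2 * (Real.log (c n) / c n)) atTop (nhds 0) := by
    have h1 := Real.isLittleO_log_id_atTop.tendsto_div_nhds_zero.comp hc
    simpa using ((tendsto_const_nhds (x := Real.log 4)).div_atTop hc).add (h1.const_mul 2)
  set D := Ψ (4 * v) - Ψ (u / 3) + 2 + Real.log 2
  have hlog43 : 0 < Real.log (4 / 3) := Real.log_pos (by norm_num)
  filter_upwards [hunif, habove, hbelow,
    hlogc.eventually (gt_mem_nhds (show 0 < ε / 3 by positivity)),
    hc.eventually_ge_atTop 1, hc.eventually_ge_atTop (D / Real.log (4 / 3))]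
    with n hunif habove hbelow hlogc hc1 hcD k _ hak hkb
  have hcn : 0 < c n := by linarith
  have hx : (k : ℝ) = k / c n * c n := by field_simp
  set x := (k : ℝ) / c n
  obtain ⟨hζ0, hζx, huζ, hζv⟩ := hinv x ((le_div_iff₀ hcn).2 hak) ((div_le_iff₀ hcn).2 hkb)
  have hab' : ∃ j, k < j ∧ (P n).coeff k * (3 * v) ^ k < (P n).coeff j * (3 * v) ^ j := by
    by_contra! hcon
    refine habove k ?_ (eval_le_of_terms_le_above (hcoeff n) hv0 (by linarith) (by linarith) k hcon)
    exact mul_le_mul_of_nonneg_right hkb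
      (Real.log_nonneg ((one_le_div hv0).2 (by linarith)))
  have hbe' : ∃ i, i < k ∧ (P n).coeff k * (u / 3) ^ k < (P n).coeff i * (u / 3) ^ i := by
    by_contra! hcon
    refine hbelow k ?_ (eval_le_of_terms_le_below (hcoeff n) (by positivity) (by linarith)
      (by linarith) k hcon)
    exact mul_le_mul_of_nonpos_right hak
      (Real.log_nonpos (by positivity) ((div_le_one hu0).2 (by linarith)))
  obtain ⟨j, hkj, hj⟩ := hab'
  obtain ⟨i, hik, hi⟩ := hbe'
  have hj0 : 0 < (P n).coeff j := pos_of_mul_pos_left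
    ((mul_nonneg (hcoeff n k) (by positivity)).trans_lt hj) (by positivity)
  have hi0 : 0 < (P n).coeff i := pos_of_mul_pos_left
    ((mul_nonneg (hcoeff n k) (by positivity)).trans_lt hi) (by positivity)
  obtain ⟨hk0, z, hz0, hmax⟩ := exists_maximal_term (hcoeff n) (hP' n).2.2 hik hkj hi0 hj0
  have hzv : z < 3 * v := lt_of_maximal_term_of_lt hz0 (by positivity) hkj hj0
    (hmax j) hj
  have huz : u / 3 < z := lt_of_lt_of_maximal_term hz0 (by positivity) hik hk0
    (hmax i) hi
  have hmin : Ψ (Φinv x) - x * Real.log (Φinv x) ≤ Ψ z - x * Real.log z := by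
    rcases eq_or_ne z (Φinv x) with rfl | hne
    · exact le_rfl
    · simpa only [hζx] using (hcrit hζ0 hz0 hne).le
  have hdiv : ∀ y, c n * ((1 / c n) * y) = y := fun y => by field_simp
  have hz_unif := abs_lt.1 (hunif z ⟨huz.le, by linarith⟩)
  have hζ_unif := abs_lt.1 (hunif (Φinv x) ⟨by linarith, by linarith⟩)
  have hv_unif := abs_lt.1 (hunif (4 * v) ⟨by linarith, le_rfl⟩)
  have hu_unif := abs_lt.1 (hunif (u / 3) ⟨le_rfl, by linarith⟩)
  have hmin1 : min (ε / 3) 1 ≤ 1 := min_le_right _ _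
  have hmin3 : min (ε / 3) 1 ≤ ε / 3 := min_le_left _ _
  have hupper : Real.log ((P n).coeff k) + k * Real.log (Φinv x) ≤
      Real.log ((P n).eval (Φinv x)) := by
    have := Real.log_le_log (by positivity) (coeff_mul_pow_le_eval (hcoeff n) k hζ0)
    rwa [Real.log_mul hk0.ne' (by positivity), Real.log_pow] at this
  have hlower := log_eval_le_log_coeff_add (hcoeff n) hz0 (show z < 4 * v by linarith)
    (hpos n z hz0) hk0 hc1 hmax (by
      have h1 : Real.log ((P n).eval (u / 3)) ≤ Real.log ((P n).eval z) :=
        Real.log_le_log (hpos n _ (by positivity))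
          (eval_le_eval_of_coeff_nonneg (hcoeff n) (by positivity) huz.le)
      have h2 : 1 / c n * Real.log ((P n).eval (4 * v)) -
          1 / c n * Real.log ((P n).eval (u / 3)) ≤ D - Real.log 2 := by
        simp only [D]; linarith [hv_unif.2, hu_unif.1]
      have h3 := mul_le_mul_of_nonneg_left h2 hcn.le
      rw [mul_sub, hdiv, hdiv] at h3
      have h4 : Real.log (4 / 3) ≤ Real.log (4 * v / z) := by
        refine Real.log_le_log (by norm_num) ?_
        rw [div_le_div_iff₀ (by norm_num) hz0]
        linarith
      have h5 : D ≤ c n * Real.log (4 / 3) := (div_le_iff₀ hlog43).1 hcD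
      have h6 : c n ^ 2 * Real.log (4 / 3) ≤ c n ^ 2 * Real.log (4 * v / z) := by gcongr
      have h7 := mul_le_mul_of_nonneg_left h5 hcn.le
      have h8 : Real.log 2 ≤ c n * Real.log 2 :=
        le_mul_of_one_le_left (Real.log_nonneg (by norm_num)) hc1
      nlinarith)
  have hinvc : 0 ≤ 1 / c n := by positivity
  have hkx : ∀ y, 1 / c n * (k * y) = x * y := fun y => by simp only [x]; ring
  have hU := mul_le_mul_of_nonneg_left hupper hinvc
  have hL := mul_le_mul_of_nonneg_left hlower hinvc
  rw [mul_add, hkx] at hU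
  have hL' : 1 / c n * Real.log ((P n).eval z) ≤ 1 / c n * Real.log ((P n).coeff k) +
      x * Real.log z + (Real.log 4 / c n + 2 * (Real.log (c n) / c n)) := by
    rw [← hkx]; refine hL.trans (le_of_eq ?_); ring
  rw [hg, abs_lt]
  constructor
  · linarith [hz_unif.1]
  · linarith [hζ_unif.2]
end

section
/- For each n \in \mathbb{N}, let \mu_n be a finite Borel measure on (-\infty, 0], and define \Psi_n(z) := \int_{(-\infty,0]} \mathrm{Log}((z-y)/(1-y)) \, d\mu_n(y) for z in the right half-plane \{ z \in \mathbb{C} : \mathrm{Re}\, z > 0 \}, where \mathrm{Log} denotes the principal branch of the complex logarithm (well defined since \mathrm{Re}((z-y)/(1-y)) > 0 for \mathrm{Re}\, z > 0 and y \le 0). Then each \Psi_n is holomorphic on \{ \mathrm{Re}\, z > 0 \}, and if \lim_{n\to\infty} \Psi_n(x) exists in \mathbb{R} for every x \in (0,\infty), then there exists a holomorphic function \Psi on \{ \mathrm{Re}\, z > 0 \} such that \Psi_n \to \Psi locally uniformly on \{ \mathrm{Re}\, z > 0 \}. -/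
open Filter Set MeasureTheory Complex

/-- Pointwise convergence of a locally equi-Lipschitz family is locally uniform. -/
theorem tendstoLocallyUniformlyOn_of_locally_lipschitz {ι : Type*} {l : Filter ι} [l.NeBot]
    {U : Set ℂ} {F : ι → ℂ → ℂ} {f : ℂ → ℂ}
    (hlip : ∀ x ∈ U, ∃ K : ℝ, ∃ t ∈ nhds x, t ⊆ U ∧ ∀ n, ∀ y ∈ t, ‖F n y - F n x‖ ≤ K * ‖y - x‖)
    (hlim : ∀ x ∈ U, Tendsto (fun n => F n x) l (nhds (f x))) :
    TendstoLocallyUniformlyOn F f l U := by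
  rw [Metric.tendstoLocallyUniformlyOn_iff]
  intro ε hε x hx
  obtain ⟨K, t, ht, htU, hK⟩ := hlip x hx
  have hsmall : ∀ᶠ y in nhds x, K * ‖y - x‖ < ε / 3 := by
    have hc : Continuous fun y : ℂ => K * ‖y - x‖ := by fun_prop
    exact hc.tendsto x |>.eventually (gt_mem_nhds (by simpa using by positivity))
  refine ⟨t ∩ {y | K * ‖y - x‖ < ε / 3}, mem_nhdsWithin_of_mem_nhds (inter_mem ht hsmall), ?_⟩
  filter_upwards [Metric.tendsto_nhds.1 (hlim x hx) (ε / 3) (by positivity)] with n hn y hy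
  have hf : ‖f y - f x‖ ≤ K * ‖y - x‖ :=
    le_of_tendsto (((hlim y (htU hy.1)).sub (hlim x hx)).norm)
      (Eventually.of_forall fun m => hK m y hy.1)
  have hF := hK n y hy.1
  have hy2 : K * ‖y - x‖ < ε / 3 := hy.2
  rw [dist_eq_norm] at hn ⊢
  calc ‖f y - F n y‖ = ‖(f y - f x) - (F n x - f x) - (F n y - F n x)‖ := by congr 1; ring
    _ ≤ ‖f y - f x‖ + ‖F n x - f x‖ + ‖F n y - F n x‖ :=
      (norm_sub_le _ _).trans (by gcongr; exact norm_sub_le _ _)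
    _ < ε := by linarith

/-- A version of Vitali's convergence theorem on the right half-plane. -/
theorem exists_tendstoLocallyUniformlyOn_of_tendsto_pos_real {F : ℕ → ℂ → ℂ}
    (hF : ∀ n, DifferentiableOn ℂ (F n) {z : ℂ | 0 < z.re})
    (hbdd : ∀ z : ℂ, 0 < z.re → ∃ M : ℝ, ∀ n, ‖F n z‖ ≤ M)
    (hlip : ∀ x ∈ {z : ℂ | 0 < z.re}, ∃ K : ℝ, ∃ t ∈ nhds x, t ⊆ {z : ℂ | 0 < z.re} ∧
      ∀ n, ∀ y ∈ t, ‖F n y - F n x‖ ≤ K * ‖y - x‖)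
    (hlim : ∀ x : ℝ, 0 < x → ∃ L : ℂ, Tendsto (fun n => F n x) atTop (nhds L)) :
    ∃ f : ℂ → ℂ, DifferentiableOn ℂ f {z : ℂ | 0 < z.re} ∧
      TendstoLocallyUniformlyOn F f atTop {z : ℂ | 0 < z.re} := by
  have hopen : IsOpen {z : ℂ | 0 < z.re} := isOpen_lt continuous_const continuous_re
  have hconn : IsPreconnected {z : ℂ | 0 < z.re} := (convex_halfSpace_re_gt 0).isPreconnected
  have key : ∀ V : Ultrafilter ℕ, ∃ g : ℂ → ℂ, DifferentiableOn ℂ g {z : ℂ | 0 < z.re} ∧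
      ∀ z : ℂ, 0 < z.re → Tendsto (fun n => F n z) V (nhds (g z)) := by
    intro V
    have hex : ∀ z : ℂ, ∃ a : ℂ, 0 < z.re → Tendsto (fun n => F n z) V (nhds a) := by
      intro z
      by_cases hz : 0 < z.re
      · obtain ⟨M, hM⟩ := hbdd z hz
        obtain ⟨a, -, ha⟩ := (isCompact_closedBall (0 : ℂ) M).ultrafilter_le_nhds
          (V.map fun n => F n z) (by
            rw [le_principal_iff]
            exact Eventually.of_forall (f := (V : Filter ℕ)) fun n => by simpa using hM n)
        exact ⟨a, fun _ => ha⟩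
      · exact ⟨0, fun h => absurd h hz⟩
    choose g hg using hex
    refine ⟨g, ?_, hg⟩
    exact (tendstoLocallyUniformlyOn_of_locally_lipschitz (l := (V : Filter ℕ)) hlip
      hg).differentiableOn (Eventually.of_forall hF) hopen
  obtain ⟨f, hf, hfl⟩ := key (hyperfilter ℕ)
  refine ⟨f, hf, tendstoLocallyUniformlyOn_of_locally_lipschitz hlip fun z hz => ?_⟩
  rw [tendsto_iff_ultrafilter]
  intro V hV
  obtain ⟨g, hg, hgl⟩ := key V
  have hreal : ∀ x : ℝ, 0 < x → g x = f x := by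
    intro x hx
    obtain ⟨L, hL⟩ := hlim x hx
    rw [tendsto_nhds_unique (hgl x (by simpa using hx)) (hL.mono_left hV),
      tendsto_nhds_unique (hfl x (by simpa using hx)) (hL.mono_left Nat.hyperfilter_le_atTop)]
  have heq : EqOn g f {z : ℂ | 0 < z.re} := by
    refine (hg.analyticOnNhd hopen).eqOn_of_preconnected_of_frequently_eq
      (hf.analyticOnNhd hopen) hconn (z₀ := 1) (by simp) ?_
    have htend : Tendsto (fun x : ℝ => (x : ℂ)) (nhdsWithin 1 {1}ᶜ) (nhdsWithin 1 {1}ᶜ) := by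
      refine tendsto_nhdsWithin_iff.2 ⟨?_, ?_⟩
      · simpa using (continuous_ofReal.tendsto (1 : ℝ)).mono_left nhdsWithin_le_nhds
      · filter_upwards [self_mem_nhdsWithin] with x hx
        simpa using hx
    refine htend.frequently (Eventually.frequently ?_)
    filter_upwards [nhdsWithin_le_nhds (lt_mem_nhds (zero_lt_one' ℝ))] with x hx
    exact hreal x hx
  rw [← heq hz]
  exact hgl z hz

theorem re_sub_div_one_sub_pos {z : ℂ} {y : ℝ} (hz : 0 < z.re) (hy : y ≤ 0) :
    0 < ((z - (y : ℂ)) / (1 - (y : ℂ))).re := by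
  have h : (1 - (y : ℂ)) = ((1 - y : ℝ) : ℂ) := by push_cast; rfl
  rw [h, div_ofReal_re]
  exact div_pos (by simp; linarith) (by linarith)

theorem hasDerivAt_log_sub_div_one_sub {z : ℂ} {y : ℝ} (hz : 0 < z.re) (hy : y ≤ 0) :
    HasDerivAt (fun z : ℂ => log ((z - (y : ℂ)) / (1 - (y : ℂ)))) (z - (y : ℂ))⁻¹ z := by
  have h1 : (1 - (y : ℂ)) ≠ 0 := by
    intro h
    have := congrArg re h
    simp at this
    linarith
  have h2 : (z - (y : ℂ)) ≠ 0 := by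
    intro h
    have := congrArg re h
    simp at this
    linarith
  have := (((hasDerivAt_id z).sub_const (y : ℂ)).div_const (1 - (y : ℂ))).clog
    (Or.inl (re_sub_div_one_sub_pos hz hy))
  convert this using 1
  simp only [id]
  field_simp
  exact (div_self h2).symm

theorem norm_inv_sub_le {z : ℂ} {y δ : ℝ} (hδ : 0 < δ) (hδ1 : δ ≤ 1) (hz : δ < z.re)
    (hy : y ≤ 0) : ‖(z - (y : ℂ))⁻¹‖ ≤ δ⁻¹ * (1 - y)⁻¹ := by
  rw [norm_inv, ← mul_inv]
  have : 0 < 1 - y := by linarith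
  refine inv_anti₀ (by positivity) ?_
  refine le_trans ?_ (re_le_norm _)
  simp
  nlinarith

theorem norm_log_sub_div_one_sub_sub_le {z w : ℂ} {y δ : ℝ} (hδ : 0 < δ) (hδ1 : δ ≤ 1)
    (hz : δ < z.re) (hw : δ < w.re) (hy : y ≤ 0) :
    ‖log ((z - (y : ℂ)) / (1 - (y : ℂ))) - log ((w - (y : ℂ)) / (1 - (y : ℂ)))‖
      ≤ δ⁻¹ * (1 - y)⁻¹ * ‖z - w‖ :=
  (convex_halfSpace_re_gt δ).norm_image_sub_le_of_norm_hasDerivWithin_le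
    (f := fun z : ℂ => log ((z - (y : ℂ)) / (1 - (y : ℂ)))) (f' := fun z => (z - (y : ℂ))⁻¹)
    (fun _ hx => (hasDerivAt_log_sub_div_one_sub (hδ.trans hx) hy).hasDerivWithinAt)
    (fun _ hx => norm_inv_sub_le hδ hδ1 hx hy) hw hz

theorem ae_nonpos_of_measure_Ioi {μ : Measure ℝ} (hs : μ (Ioi 0) = 0) : ∀ᵐ y ∂μ, y ≤ 0 := by
  rw [ae_iff]
  simpa [Ioi] using hs

section Potential

variable {μ : Measure ℝ} [IsFiniteMeasure μ]

theorem integrable_inv_one_sub (hs : μ (Ioi 0) = 0) : Integrable (fun y : ℝ => (1 - y)⁻¹) μ := by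
  refine Integrable.of_bound (C := 1) (by fun_prop) ?_
  filter_upwards [ae_nonpos_of_measure_Ioi hs] with y hy
  rw [norm_inv, Real.norm_of_nonneg (by linarith)]
  exact inv_le_one_of_one_le₀ (by linarith)

theorem integrable_log_sub_div_one_sub (hs : μ (Ioi 0) = 0) {z : ℂ} (hz : 0 < z.re) :
    Integrable (fun y : ℝ => log ((z - (y : ℂ)) / (1 - (y : ℂ)))) μ := by
  have hδ : 0 < min (z.re / 2) (1 / 2) := by positivity
  refine ((integrable_inv_one_sub hs).const_mul (min (z.re / 2) (1 / 2))⁻¹).mul_const ‖z - 1‖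
    |>.mono' (Measurable.aestronglyMeasurable (by fun_prop)) ?_
  filter_upwards [ae_nonpos_of_measure_Ioi hs] with y hy
  have h1 : (1 - (y : ℂ)) ≠ 0 := by
    intro h
    have := congrArg re h
    simp at this
    linarith
  have := norm_log_sub_div_one_sub_sub_le (z := z) (w := 1) hδ
    ((min_le_right _ _).trans (by norm_num))
    ((min_le_left _ _).trans_lt (by linarith)) ((min_le_right _ _).trans_lt (by norm_num)) hy
  simpa [div_self h1] using this

theorem norm_integral_log_sub_le (hs : μ (Ioi 0) = 0) {z w : ℂ} {δ : ℝ} (hδ : 0 < δ)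
    (hδ1 : δ ≤ 1) (hz : δ < z.re) (hw : δ < w.re) :
    ‖(∫ y : ℝ, log ((z - (y : ℂ)) / (1 - (y : ℂ))) ∂μ)
        - ∫ y : ℝ, log ((w - (y : ℂ)) / (1 - (y : ℂ))) ∂μ‖
      ≤ δ⁻¹ * (∫ y : ℝ, (1 - y)⁻¹ ∂μ) * ‖z - w‖ := by
  rw [← integral_sub (integrable_log_sub_div_one_sub hs (hδ.trans hz))
    (integrable_log_sub_div_one_sub hs (hδ.trans hw)), ← integral_const_mul, ← integral_mul_const]
  refine norm_integral_le_of_norm_le (((integrable_inv_one_sub hs).const_mul _).mul_const _) ?_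
  filter_upwards [ae_nonpos_of_measure_Ioi hs] with y hy
  exact norm_log_sub_div_one_sub_sub_le hδ hδ1 hz hw hy

theorem differentiableOn_integral_log (hs : μ (Ioi 0) = 0) :
    DifferentiableOn ℂ (fun z => ∫ y : ℝ, log ((z - (y : ℂ)) / (1 - (y : ℂ))) ∂μ)
      {z : ℂ | 0 < z.re} := by
  intro z hz
  have hz : 0 < z.re := hz
  have hδ : 0 < min (z.re / 2) 1 := by positivity
  have ht : {w : ℂ | min (z.re / 2) 1 < w.re} ∈ nhds z :=
    (isOpen_lt continuous_const continuous_re).mem_nhds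
      (show min (z.re / 2) 1 < z.re from (min_le_left _ _).trans_lt (by linarith))
  refine (hasDerivAt_integral_of_dominated_loc_of_deriv_le
    (F := fun (z : ℂ) (y : ℝ) => log ((z - (y : ℂ)) / (1 - (y : ℂ))))
    (F' := fun z y => (z - (y : ℂ))⁻¹) (bound := fun y => (min (z.re / 2) 1)⁻¹ * (1 - y)⁻¹) ht
    (Eventually.of_forall fun w => Measurable.aestronglyMeasurable (by fun_prop))
    (integrable_log_sub_div_one_sub hs hz) (Measurable.aestronglyMeasurable (by fun_prop))
    ?_ ((integrable_inv_one_sub hs).const_mul _)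
    ?_).2.differentiableAt.differentiableWithinAt
  · filter_upwards [ae_nonpos_of_measure_Ioi hs] with y hy w hw
    exact norm_inv_sub_le hδ (min_le_right _ _) hw hy
  · filter_upwards [ae_nonpos_of_measure_Ioi hs] with y hy w hw
    exact hasDerivAt_log_sub_div_one_sub (hδ.trans hw) hy

theorem integral_inv_one_sub_le (hs : μ (Ioi 0) = 0) :
    ∫ y : ℝ, (1 - y)⁻¹ ∂μ ≤ 2 * ‖∫ y : ℝ, log ((2 - (y : ℂ)) / (1 - (y : ℂ))) ∂μ‖ := by
  have hi := integrable_log_sub_div_one_sub hs (z := 2) (by simp)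
  calc ∫ y : ℝ, (1 - y)⁻¹ ∂μ ≤ ∫ y : ℝ, 2 * (log ((2 - (y : ℂ)) / (1 - (y : ℂ)))).re ∂μ := by
        refine integral_mono_ae (integrable_inv_one_sub hs) (hi.re.const_mul 2) ?_
        filter_upwards [ae_nonpos_of_measure_Ioi hs] with y hy
        have h1 : 0 < 1 - y := by linarith
        have h2 : 0 < 2 - y := by linarith
        have he : (2 - (y : ℂ)) / (1 - (y : ℂ)) = (((2 - y) / (1 - y) : ℝ) : ℂ) := by push_cast; rfl
        rw [he, log_ofReal_re]
        have hl := Real.one_sub_inv_le_log_of_pos (div_pos h2 h1)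
        have : (1 - y)⁻¹ ≤ 2 * (1 - ((2 - y) / (1 - y))⁻¹) := by
          rw [inv_div, one_sub_div h2.ne', ← one_div, ← mul_div_assoc, div_le_div_iff₀ h1 h2]
          nlinarith
        linarith
    _ = 2 * (∫ y : ℝ, log ((2 - (y : ℂ)) / (1 - (y : ℂ))) ∂μ).re := by
        rw [integral_const_mul]
        congr 1
        exact integral_re hi
    _ ≤ _ := by
        gcongr
        exact re_le_norm _

end Potential

/-- **Holomorphy and locally uniform convergence of logarithmic potentials.**
For finite Borel measures `μ n` on `(-∞,0]`, the functions
`Ψ_n(z) = ∫ Log((z-y)/(1-y)) dμ_n(y)` are holomorphic on the right half-plane, and if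
`Ψ_n(x)` converges in `ℝ` for every `x ∈ (0,∞)`, then `Ψ_n` converges locally uniformly
on the right half-plane to a holomorphic function `Ψ`. -/
theorem log_potentials_holomorphic_and_loc_unif_convergence
    (μ : ℕ → Measure ℝ) (hfin : ∀ n, IsFiniteMeasure (μ n))
    (hsupp : ∀ n, μ n (Set.Ioi (0 : ℝ)) = 0)
    (Ψn : ℕ → ℂ → ℂ)
    (hΨn : ∀ n z, Ψn n z = ∫ y : ℝ, Complex.log ((z - (y : ℂ)) / (1 - (y : ℂ))) ∂(μ n)) :
    (∀ n, DifferentiableOn ℂ (Ψn n) {z : ℂ | 0 < z.re}) ∧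
    ((∀ x : ℝ, 0 < x → ∃ L : ℝ, Tendsto (fun n => Ψn n (x : ℂ)) atTop (nhds (L : ℂ))) →
      ∃ Ψ : ℂ → ℂ, DifferentiableOn ℂ Ψ {z : ℂ | 0 < z.re} ∧
        TendstoLocallyUniformlyOn Ψn Ψ atTop {z : ℂ | 0 < z.re}) := by
  obtain rfl : Ψn = fun n z => ∫ y : ℝ, log ((z - (y : ℂ)) / (1 - (y : ℂ))) ∂(μ n) := by
    funext n z
    exact hΨn n z
  have hdiff := fun n => differentiableOn_integral_log (hsupp n)
  refine ⟨hdiff, fun hlim => ?_⟩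
  obtain ⟨C, hC⟩ : ∃ C : ℝ, ∀ n, ∫ y : ℝ, (1 - y)⁻¹ ∂(μ n) ≤ C := by
    obtain ⟨L, hL⟩ := hlim 2 (by norm_num)
    obtain ⟨M, hM⟩ := hL.norm.bddAbove_range
    refine ⟨2 * M, fun n => (integral_inv_one_sub_le (hsupp n)).trans ?_⟩
    gcongr
    exact hM ⟨n, by simp⟩
  have hlip : ∀ {δ : ℝ} {z w : ℂ}, 0 < δ → δ ≤ 1 → δ < z.re → δ < w.re → ∀ n,
      ‖(∫ y : ℝ, log ((z - (y : ℂ)) / (1 - (y : ℂ))) ∂(μ n))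
        - ∫ y : ℝ, log ((w - (y : ℂ)) / (1 - (y : ℂ))) ∂(μ n)‖ ≤ δ⁻¹ * C * ‖z - w‖ := by
    intro δ z w hδ hδ1 hz hw n
    refine (norm_integral_log_sub_le (hsupp n) hδ hδ1 hz hw).trans ?_
    gcongr
    exact hC n
  refine exists_tendstoLocallyUniformlyOn_of_tendsto_pos_real hdiff (fun z hz => ?_)
    (fun x hx => ?_) fun x hx => (hlim x hx).imp' _ fun _ h => h
  · have hδ : 0 < min (z.re / 2) (1 / 2) := by positivity
    refine ⟨(min (z.re / 2) (1 / 2))⁻¹ * C * ‖z - 1‖, fun n => ?_⟩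
    have h := hlip (z := z) (w := 1) hδ ((min_le_right _ _).trans (by norm_num))
      ((min_le_left _ _).trans_lt (by linarith)) ((min_le_right _ _).trans_lt (by norm_num)) n
    have h0 : ∫ y : ℝ, log ((1 - (y : ℂ)) / (1 - (y : ℂ))) ∂(μ n) = 0 := by
      refine integral_eq_zero_of_ae (Eventually.of_forall fun y => ?_)
      by_cases hy : (1 - (y : ℂ)) = 0
      · simp [hy]
      · simp [div_self hy]
    rwa [h0, sub_zero] at h
  · have hx : 0 < x.re := hx
    have hδ : 0 < min (x.re / 2) 1 := by positivity
    have hxδ : min (x.re / 2) 1 < x.re := (min_le_left _ _).trans_lt (by linarith)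
    exact ⟨_, {w : ℂ | min (x.re / 2) 1 < w.re},
      (isOpen_lt continuous_const continuous_re).mem_nhds hxδ, fun w hw => hδ.trans hw,
      fun n w hw => hlip hδ (min_le_right _ _) hw hxδ n⟩
end

section
/- Fix \alpha > 0. For each n \in \mathbb{N}, let M_n be an n \times n real symmetric matrix all of whose eigenvalues lie in the open interval (0,1). Assume that for every integer k \ge 1, \lim_{n\to\infty} (1/(2n)) \, \mathrm{Tr}(M_n^k) = (2/\pi) \int_0^1 e^{-k\alpha^2 s^2} \sqrt{1-s^2} \, ds. Then for every z \in (0,1): \lim_{n\to\infty} (1/(2n)) \log \det( I_n + (z-1) M_n ) = \Psi_w(z;\alpha), where \Psi_w(z;\alpha) := (2/\pi) \int_0^1 \log( 1 - (1-z) e^{-\alpha^2 s^2} ) \sqrt{1-s^2} \, ds. -/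
open Filter Matrix Real MeasureTheory

namespace Matrix

variable {m : Type*} [Fintype m] [DecidableEq m] {A : Matrix m m ℝ}

/-- The trace of a power of a real symmetric matrix is the power sum of its eigenvalues. -/
lemma IsHermitian.trace_pow_eq_sum (hA : A.IsHermitian) (k : ℕ) :
    trace (A ^ k) = ∑ i, hA.eigenvalues i ^ k := by
  conv_lhs => rw [hA.spectral_theorem, ← map_pow, Unitary.conjStarAlgAut_apply, trace_mul_comm,
    ← mul_assoc]
  simp [diagonal_pow, trace_diagonal]

/-- The determinant of an affine perturbation of the identity by a real symmetric matrix. -/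
lemma IsHermitian.det_one_add_smul_eq_prod (hA : A.IsHermitian) (c : ℝ) :
    det (1 + c • A) = ∏ i, (1 + c * hA.eigenvalues i) := by
  have h : 1 + c • A = Unitary.conjStarAlgAut ℝ _ hA.eigenvectorUnitary
      (diagonal fun i => 1 + c * hA.eigenvalues i) := by
    have hd : (diagonal fun i => 1 + c * hA.eigenvalues i) =
        1 + c • diagonal (RCLike.ofReal ∘ hA.eigenvalues) := by
      rw [← diagonal_one, ← diagonal_smul, diagonal_add]
      rfl
    rw [hd, map_add, map_one, map_smul, ← hA.spectral_theorem]
  rw [h, Unitary.conjStarAlgAut_apply, det_mul_comm, ← mul_assoc]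
  simp [det_diagonal]

/-- The power series of `log det (1 - w A)` in terms of the traces of the powers of `A`. -/
lemma IsHermitian.hasSum_log_det (hA : A.IsHermitian)
    (heig : ∀ i, hA.eigenvalues i ∈ Set.Ioo (0 : ℝ) 1) {w : ℝ} (hw : w ∈ Set.Ioo (0 : ℝ) 1) :
    HasSum (fun k : ℕ => -(w ^ (k + 1) / (k + 1)) * trace (A ^ (k + 1)))
      (Real.log (det (1 + (-w) • A))) := by
  have hlt : ∀ i, w * hA.eigenvalues i < 1 := fun i => by
    nlinarith [(heig i).1, (heig i).2, hw.1, hw.2]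
  rw [hA.det_one_add_smul_eq_prod, Real.log_prod fun i _ => by linarith [hlt i]]
  have h := hasSum_sum (s := Finset.univ) fun i _ =>
    (Real.hasSum_pow_div_log_of_abs_lt_one (x := w * hA.eigenvalues i) (by
      rw [abs_of_pos (mul_pos hw.1 (heig i).1)]; exact hlt i)).neg
  convert! h using 1
  · funext k
    rw [hA.trace_pow_eq_sum, Finset.mul_sum]
    exact Finset.sum_congr rfl fun i _ => by rw [mul_pow]; ring
  · exact Finset.sum_congr rfl fun i _ => by rw [neg_neg]; congr 1; ring

end Matrix

/-- Termwise integration of the logarithmic series of a function with values in `[0,1]`,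
against a bounded weight. -/
lemma hasSum_integral_log_one_sub_mul {f g : ℝ → ℝ} (hf : Continuous f) (hg : Continuous g)
    (hf0 : ∀ s, 0 ≤ f s) (hf1 : ∀ s, f s ≤ 1) (hg1 : ∀ s, |g s| ≤ 1) {w : ℝ}
    (hw : w ∈ Set.Ioo (0 : ℝ) 1) (a b : ℝ) :
    HasSum (fun k : ℕ => -(w ^ (k + 1) / (k + 1)) * ∫ s in a..b, f s ^ (k + 1) * g s)
      (∫ s in a..b, Real.log (1 - w * f s) * g s) := by
  simp_rw [← intervalIntegral.integral_const_mul]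
  refine intervalIntegral.hasSum_integral_of_dominated_convergence (fun k _ => w ^ (k + 1))
    (fun k => by fun_prop) (fun k => .of_forall fun s _ => ?_)
    (.of_forall fun s _ => ?_) intervalIntegrable_const (.of_forall fun s _ => ?_)
  · have hw0 := pow_nonneg hw.1.le (k + 1)
    have hdiv : w ^ (k + 1) / ((k : ℝ) + 1) ≤ w ^ (k + 1) :=
      div_le_self hw0 (by linarith [k.cast_nonneg (α := ℝ)])
    have hp := pow_nonneg (hf0 s) (k + 1)
    rw [norm_mul, norm_neg, norm_mul,
      Real.norm_of_nonneg (by positivity : 0 ≤ w ^ (k + 1) / ((k : ℝ) + 1)),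
      Real.norm_of_nonneg hp, Real.norm_eq_abs]
    calc _ ≤ w ^ (k + 1) * (1 * 1) := by
          gcongr
          · exact pow_le_one₀ (hf0 s) (hf1 s)
          · exact hg1 s
      _ = _ := by ring
  · exact (summable_nat_add_iff 1).2 (summable_geometric_of_lt_one hw.1.le hw.2)
  · have hlt : w * f s < 1 := by nlinarith [hf0 s, hf1 s, hw.1, hw.2]
    have h := ((Real.hasSum_pow_div_log_of_abs_lt_one (x := w * f s) (by
      rwa [abs_of_nonneg (mul_nonneg hw.1.le (hf0 s))])).neg).mul_right (g s)
    rw [neg_neg] at h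
    convert! h using 1
    funext k
    rw [mul_pow]
    ring

/-- **Limit of the generating function in the weak asymmetry regime.**
If `M n` are real symmetric matrices with eigenvalues in `(0,1)` and
`(1/(2n)) Tr(M_n^k) → (2/π) ∫_0^1 e^{-kα²s²} √(1-s²) ds` for every `k ≥ 1`, then for
every `z ∈ (0,1)`,
`(1/(2n)) log det(I + (z-1) M_n) → (2/π) ∫_0^1 log(1-(1-z)e^{-α²s²}) √(1-s²) ds`. -/
theorem weak_asymmetry_generating_function_limit
    (α : ℝ) (hα : 0 < α)
    (M : (n : ℕ) → Matrix (Fin n) (Fin n) ℝ)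
    (hM : ∀ n, (M n).IsHermitian)
    (heig : ∀ n i, (hM n).eigenvalues i ∈ Set.Ioo (0 : ℝ) 1)
    (htr : ∀ k : ℕ, 1 ≤ k →
      Tendsto (fun n : ℕ => (1 / (2 * (n : ℝ))) * Matrix.trace (M n ^ k)) atTop
        (nhds ((2 / π) * ∫ s in (0:ℝ)..1,
          Real.exp (-(k : ℝ) * α ^ 2 * s ^ 2) * Real.sqrt (1 - s ^ 2)))) :
    ∀ z ∈ Set.Ioo (0 : ℝ) 1,
      Tendsto (fun n : ℕ =>
          (1 / (2 * (n : ℝ))) * Real.log (Matrix.det (1 + (z - 1) • M n))) atTop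
        (nhds ((2 / π) * ∫ s in (0:ℝ)..1,
          Real.log (1 - (1 - z) * Real.exp (-α ^ 2 * s ^ 2)) * Real.sqrt (1 - s ^ 2))) := by
  intro z hz
  have hw : 1 - z ∈ Set.Ioo (0 : ℝ) 1 := ⟨by linarith [hz.2], by linarith [hz.1]⟩
  have hint := (hasSum_integral_log_one_sub_mul
    (f := fun s => Real.exp (-α ^ 2 * s ^ 2)) (g := fun s => Real.sqrt (1 - s ^ 2))
    (by fun_prop) (by fun_prop) (fun s => (Real.exp_pos _).le)
    (fun s => Real.exp_le_one_iff.2 (by nlinarith [mul_nonneg (sq_nonneg α) (sq_nonneg s)]))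
    (fun s => by
      rw [abs_of_nonneg (Real.sqrt_nonneg _), Real.sqrt_le_iff]
      constructor <;> nlinarith [sq_nonneg s]) hw 0 1).mul_left (2 / π)
  have hdet : ∀ n : ℕ, HasSum (fun k : ℕ => -((1 - z) ^ (k + 1) / (k + 1)) *
        (1 / (2 * (n : ℝ)) * Matrix.trace (M n ^ (k + 1))))
      (1 / (2 * (n : ℝ)) * Real.log (Matrix.det (1 + (z - 1) • M n))) := fun n => by
    have h := ((hM n).hasSum_log_det (heig n) hw).mul_left (1 / (2 * (n : ℝ)))
    rw [neg_sub] at h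
    convert! h using 2
    ring
  rw [← hint.tsum_eq]
  simp_rw [← fun n : ℕ => (hdet n).tsum_eq]
  refine tendsto_tsum_of_dominated_convergence (bound := fun k => (1 - z) ^ (k + 1))
    ((summable_nat_add_iff 1).2 (summable_geometric_of_lt_one hw.1.le hw.2))
    (fun k => ?_) (.of_forall fun n k => ?_)
  · have h := (htr (k + 1) k.succ_pos).const_mul (-((1 - z) ^ (k + 1) / ((k : ℝ) + 1)))
    convert! h using 2
    rw [mul_left_comm]
    congr 3
    funext s
    rw [← Real.exp_nat_mul]
    congr 2
    ring
  · have hw0 := pow_nonneg hw.1.le (k + 1)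
    have hdiv : (1 - z) ^ (k + 1) / ((k : ℝ) + 1) ≤ (1 - z) ^ (k + 1) :=
      div_le_self hw0 (by linarith [k.cast_nonneg (α := ℝ)])
    have htr0 : 0 ≤ Matrix.trace (M n ^ (k + 1)) := by
      rw [(hM n).trace_pow_eq_sum]
      exact Finset.sum_nonneg fun i _ => pow_nonneg (heig n i).1.le _
    have htrn : Matrix.trace (M n ^ (k + 1)) ≤ n := by
      rw [(hM n).trace_pow_eq_sum]
      simpa using Finset.sum_le_sum (s := Finset.univ) fun i _ =>
        pow_le_one₀ (n := k + 1) (heig n i).1.le (heig n i).2.le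
    have hmean : 1 / (2 * (n : ℝ)) * Matrix.trace (M n ^ (k + 1)) ≤ 1 := by
      rw [one_div_mul_eq_div]
      exact div_le_one_of_le₀ (by linarith [n.cast_nonneg (α := ℝ)]) (by positivity)
    rw [norm_mul, norm_neg,
      Real.norm_of_nonneg (by positivity : 0 ≤ (1 - z) ^ (k + 1) / ((k : ℝ) + 1)),
      Real.norm_of_nonneg (by positivity)]
    calc _ ≤ (1 - z) ^ (k + 1) * 1 := by gcongr
      _ = _ := mul_one _
end

section
/- For every real x \ge 0: \int_0^1 e^{-x s^2} \sqrt{1-s^2} \, ds = (\pi/4) \, e^{-x/2} \big( I_0(x/2) + I_1(x/2) \big), where I_0(y) := \sum_{k=0}^{\infty} (y/2)^{2k} / (k!)^2 and I_1(y) := \sum_{k=0}^{\infty} (y/2)^{2k+1} / (k! (k+1)!) are the modified Bessel functions of the first kind of orders 0 and 1. -/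
open Real MeasureTheory

/-- The modified Bessel function of the first kind of order `0`:
`I₀(y) = ∑_{k≥0} (y/2)^{2k} / (k!)²`. -/
noncomputable def besselI0 (y : ℝ) : ℝ :=
  ∑' k : ℕ, (y / 2) ^ (2 * k) / ((k.factorial : ℝ) ^ 2)

/-- The modified Bessel function of the first kind of order `1`:
`I₁(y) = ∑_{k≥0} (y/2)^{2k+1} / (k! (k+1)!)`. -/
noncomputable def besselI1 (y : ℝ) : ℝ :=
  ∑' k : ℕ, (y / 2) ^ (2 * k + 1) / ((k.factorial : ℝ) * ((k + 1).factorial : ℝ))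

/-- Odd moments of the cosine over a half period vanish. -/
theorem integral_cos_pow_odd_zero_pi (k : ℕ) : ∫ t in (0:ℝ)..π, cos t ^ (2 * k + 1) = 0 := by
  induction k with
  | zero => simp
  | succ k ih =>
    rw [show 2 * (k + 1) + 1 = (2 * k + 1) + 2 by ring, integral_cos_pow, ih]
    simp

/-- Even moments of the cosine over a half period. -/
theorem integral_cos_pow_even_zero_pi (k : ℕ) :
    ∫ t in (0:ℝ)..π, cos t ^ (2 * k) =
      π * (2 * k).factorial / (2 ^ (2 * k) * (k.factorial : ℝ) ^ 2) := by
  induction k with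
  | zero => simp
  | succ k ih =>
    rw [show 2 * (k + 1) = 2 * k + 2 by ring, integral_cos_pow, ih]
    have hk : (k.factorial : ℝ) ≠ 0 := by positivity
    simp only [Nat.factorial_succ, sin_pi, sin_zero]
    push_cast
    field_simp
    ring

theorem hasSum_integral_exp_mul_cos_mul_cos_pow (y : ℝ) (m : ℕ) :
    HasSum (fun n : ℕ => y ^ n / n.factorial * ∫ t in (0:ℝ)..π, cos t ^ (n + m))
      (∫ t in (0:ℝ)..π, exp (y * cos t) * cos t ^ m) := by
  have hexp (z : ℝ) : HasSum (fun n : ℕ => z ^ n / n.factorial) (exp z) := by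
    rw [Real.exp_eq_exp_ℝ]
    exact NormedSpace.expSeries_div_hasSum_exp z
  have hs := intervalIntegral.hasSum_integral_of_dominated_convergence (μ := volume)
    (a := 0) (b := π)
    (F := fun (n : ℕ) t => y ^ n / n.factorial * cos t ^ (n + m))
    (f := fun t => exp (y * cos t) * cos t ^ m)
    (fun n _ => |y| ^ n / n.factorial)
    (fun n => (by fun_prop : Continuous _).aestronglyMeasurable)
    (fun n => .of_forall fun t _ => by
      rw [norm_mul, norm_div, norm_pow, norm_pow, Real.norm_natCast, Real.norm_eq_abs,
        Real.norm_eq_abs]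
      exact mul_le_of_le_one_right (by positivity) (pow_le_one₀ (abs_nonneg _) (abs_cos_le_one t)))
    (.of_forall fun t _ => (hexp |y|).summable)
    intervalIntegrable_const
    (.of_forall fun t _ => by
      convert! (hexp (y * cos t)).mul_right (cos t ^ m) using 2 with n
      rw [mul_pow, pow_add]
      ring)
  simpa only [intervalIntegral.integral_const_mul] using hs

/-- Integral representation of `I₀`. -/
theorem integral_exp_mul_cos (y : ℝ) :
    ∫ t in (0:ℝ)..π, exp (y * cos t) = π * besselI0 y := by
  have hs := hasSum_integral_exp_mul_cos_mul_cos_pow y 0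
  simp only [add_zero, pow_zero, mul_one] at hs
  have hinj : Function.Injective fun k : ℕ => 2 * k := fun a b h => by simpa using h
  rw [← hinj.hasSum_iff] at hs
  · rw [besselI0, ← tsum_mul_left, ← hs.tsum_eq]
    refine tsum_congr fun k => ?_
    simp only [Function.comp_apply, integral_cos_pow_even_zero_pi]
    have : ((2 * k).factorial : ℝ) ≠ 0 := by positivity
    rw [div_pow]
    field_simp
  · intro n hn
    obtain ⟨k, rfl | rfl⟩ := n.even_or_odd'
    · exact absurd ⟨k, rfl⟩ hn
    · rw [integral_cos_pow_odd_zero_pi, mul_zero]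

/-- Integral representation of `I₁`. -/
theorem integral_exp_mul_cos_mul_cos (y : ℝ) :
    ∫ t in (0:ℝ)..π, exp (y * cos t) * cos t = π * besselI1 y := by
  have hs := hasSum_integral_exp_mul_cos_mul_cos_pow y 1
  simp only [pow_one] at hs
  have hinj : Function.Injective fun k : ℕ => 2 * k + 1 := fun a b h => by simpa using h
  rw [← hinj.hasSum_iff] at hs
  · rw [besselI1, ← tsum_mul_left, ← hs.tsum_eq]
    refine tsum_congr fun k => ?_
    simp only [Function.comp_apply]
    rw [show 2 * k + 1 + 1 = 2 * (k + 1) by ring, integral_cos_pow_even_zero_pi,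
      show 2 * (k + 1) = 2 * k + 1 + 1 by ring, Nat.factorial_succ (2 * k + 1),
      Nat.factorial_succ k]
    have : ((2 * k + 1).factorial : ℝ) ≠ 0 := by positivity
    have : (k.factorial : ℝ) ≠ 0 := by positivity
    push_cast
    rw [div_pow]
    field_simp
    ring
  · intro n hn
    obtain ⟨k, rfl | rfl⟩ := n.even_or_odd'
    · rw [integral_cos_pow_odd_zero_pi, mul_zero]
    · exact absurd ⟨k, rfl⟩ hn

/-- **Bessel integral identity.** For every `x ≥ 0`,
`∫_0^1 e^{-x s²} √(1-s²) ds = (π/4) e^{-x/2} (I₀(x/2) + I₁(x/2))`. -/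
theorem integral_exp_sqrt_eq_bessel (x : ℝ) (hx : 0 ≤ x) :
    ∫ s in (0:ℝ)..1, Real.exp (-x * s ^ 2) * Real.sqrt (1 - s ^ 2) =
      (π / 4) * Real.exp (-x / 2) * (besselI0 (x / 2) + besselI1 (x / 2)) := by
  have hsub := intervalIntegral.integral_comp_mul_deriv (a := 0) (b := π)
    (f := fun t => sin (t / 2)) (f' := fun t => cos (t / 2) * (1 / 2))
    (g := fun s => exp (-x * s ^ 2) * √(1 - s ^ 2))
    (fun t _ => ((hasDerivAt_id t).div_const 2).sin) (by fun_prop) (by fun_prop)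
  simp only [zero_div, sin_zero, sin_pi_div_two] at hsub
  have hint (m : ℕ) : IntervalIntegrable (fun t => exp (x / 2 * cos t) * cos t ^ m)
      volume 0 π := (by fun_prop : Continuous _).intervalIntegrable _ _
  have h0 := hint 0
  have h1 := hint 1
  simp only [pow_zero, mul_one, pow_one] at h0 h1
  calc _ = ∫ t in (0:ℝ)..π, exp (-x / 2) / 4 *
        (exp (x / 2 * cos t) + exp (x / 2 * cos t) * cos t) := by
        rw [← hsub]
        refine intervalIntegral.integral_congr fun t ht => ?_
        rw [Set.uIcc_of_le pi_pos.le] at ht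
        have hcos : 0 ≤ cos (t / 2) :=
          cos_nonneg_of_mem_Icc ⟨by linarith [ht.1, pi_pos], by linarith [ht.2]⟩
        have hsq : cos (t / 2) ^ 2 = (1 + cos t) / 2 := by
          rw [cos_sq, mul_div_cancel₀ t two_ne_zero]
          ring
        have hexp : exp (-x * sin (t / 2) ^ 2) = exp (-x / 2) * exp (x / 2 * cos t) := by
          rw [← exp_add, sin_sq, hsq]
          ring_nf
        simp only [Function.comp_apply]
        rw [← cos_sq', sqrt_sq hcos, hexp]
        linear_combination exp (-x / 2) * exp (x / 2 * cos t) / 2 * hsq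
    _ = _ := by
        rw [intervalIntegral.integral_const_mul, intervalIntegral.integral_add h0 h1,
          integral_exp_mul_cos, integral_exp_mul_cos_mul_cos]
        ring
end

section
/- The integral \int_0^{\infty} \log( 1 - e^{-t^2} ) \, dt converges absolutely and equals -(\sqrt{\pi}/2) \, \zeta(3/2); equivalently, -(2/\sqrt{\pi}) \int_0^{\infty} \log(1 - e^{-t^2}) \, dt = \zeta(3/2). -/
open Real MeasureTheory Set

/-- The terms of the Taylor expansion of `-log (1 - exp (-t ^ 2))` are Gaussian. -/
lemma exp_neg_sq_pow_div (n : ℕ) (t : ℝ) :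
    rexp (-t ^ 2) ^ (n + 1) / (n + 1) = rexp (-(n + 1 : ℝ) * t ^ 2) / (n + 1) := by
  rw [← Real.exp_nat_mul]
  push_cast
  ring_nf

lemma integrableOn_exp_neg_sq_pow_div (n : ℕ) :
    IntegrableOn (fun t : ℝ => rexp (-t ^ 2) ^ (n + 1) / (n + 1)) (Ioi 0) := by
  simp_rw [exp_neg_sq_pow_div]
  exact ((integrable_exp_neg_mul_sq (by positivity)).div_const _).integrableOn

lemma integral_exp_neg_sq_pow_div (n : ℕ) :
    ∫ t in Ioi (0 : ℝ), rexp (-t ^ 2) ^ (n + 1) / (n + 1) =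
      √π / 2 * (1 / (n + 1 : ℝ) ^ (3 / 2 : ℝ)) := by
  have hn : (0 : ℝ) < n + 1 := by positivity
  simp_rw [exp_neg_sq_pow_div]
  rw [integral_div, integral_gaussian_Ioi, Real.sqrt_div pi_pos.le,
    show (3 / 2 : ℝ) = 1 / 2 + 1 by norm_num, Real.rpow_add hn, Real.rpow_one,
    ← Real.sqrt_eq_rpow]
  field_simp

lemma summable_one_div_nat_add_one_rpow_three_halves :
    Summable fun n : ℕ => 1 / (n + 1 : ℝ) ^ (3 / 2 : ℝ) := by
  have h := (summable_nat_add_iff 1).2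
    (Real.summable_one_div_nat_rpow.2 (by norm_num : (1 : ℝ) < 3 / 2))
  exact_mod_cast h

lemma riemannZeta_three_halves :
    riemannZeta (3 / 2) = ((∑' n : ℕ, 1 / (n + 1 : ℝ) ^ (3 / 2 : ℝ) : ℝ) : ℂ) := by
  rw [zeta_eq_tsum_one_div_nat_add_one_cpow (by norm_num), Complex.ofReal_tsum]
  refine tsum_congr fun n => ?_
  rw [Complex.ofReal_div, Complex.ofReal_cpow (by positivity)]
  push_cast
  rfl

lemma integral_log_one_sub_exp_neg_sq :
    ∫ t in Ioi (0 : ℝ), Real.log (1 - rexp (-t ^ 2)) =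
      -(√π / 2) * ∑' n : ℕ, 1 / (n + 1 : ℝ) ^ (3 / 2 : ℝ) := by
  have hsum := integral_tsum_of_summable_integral_norm integrableOn_exp_neg_sq_pow_div (by
    have hnorm (n : ℕ) (t : ℝ) :
        ‖rexp (-t ^ 2) ^ (n + 1) / (n + 1 : ℝ)‖ = rexp (-t ^ 2) ^ (n + 1) / (n + 1) :=
      Real.norm_of_nonneg (by positivity)
    simp_rw [hnorm, integral_exp_neg_sq_pow_div]
    exact summable_one_div_nat_add_one_rpow_three_halves.mul_left _)
  have hlog : ∫ t in Ioi (0 : ℝ), ∑' n : ℕ, rexp (-t ^ 2) ^ (n + 1) / (n + 1 : ℝ) =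
      ∫ t in Ioi (0 : ℝ), -Real.log (1 - rexp (-t ^ 2)) := by
    refine setIntegral_congr_fun measurableSet_Ioi fun t (ht : 0 < t) => ?_
    refine (Real.hasSum_pow_div_log_of_abs_lt_one ?_).tsum_eq
    rw [Real.abs_exp, Real.exp_lt_one_iff]
    exact neg_lt_zero.2 (by positivity)
  simp_rw [integral_exp_neg_sq_pow_div] at hsum
  rw [hlog, integral_neg, tsum_mul_left] at hsum
  linarith

/-- **Zeta value integral.** The integral `∫_0^∞ log(1 - e^{-t²}) dt` converges absolutely
and equals `-(√π/2) ζ(3/2)`; equivalently `-(2/√π) ∫_0^∞ log(1-e^{-t²}) dt = ζ(3/2)`. -/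
theorem integral_log_one_sub_exp_eq_zeta :
    MeasureTheory.IntegrableOn
      (fun t : ℝ => Real.log (1 - Real.exp (-t ^ 2))) (Set.Ioi 0) ∧
    ((∫ t in Set.Ioi (0 : ℝ), Real.log (1 - Real.exp (-t ^ 2)) : ℝ) : ℂ) =
      -(((Real.sqrt π / 2 : ℝ)) : ℂ) * riemannZeta ((3 : ℂ) / 2) ∧
    (((-(2 / Real.sqrt π) * ∫ t in Set.Ioi (0 : ℝ), Real.log (1 - Real.exp (-t ^ 2)) : ℝ)) : ℂ) =
      riemannZeta ((3 : ℂ) / 2) := by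
  have hpi : 0 < √π := Real.sqrt_pos.2 pi_pos
  have hpos : 0 < ∑' n : ℕ, 1 / (n + 1 : ℝ) ^ (3 / 2 : ℝ) :=
    summable_one_div_nat_add_one_rpow_three_halves.tsum_pos (fun n => by positivity) 0
      (by positivity)
  rw [integral_log_one_sub_exp_neg_sq, riemannZeta_three_halves]
  refine ⟨?_, by push_cast; rfl, ?_⟩
  · -- a non-integrable function would have integral zero
    by_contra h
    have h0 := integral_log_one_sub_exp_neg_sq
    rw [integral_undef h] at h0
    have := mul_pos (half_pos hpi) hpos
    linarith
  · congr 1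
    field_simp
end

section
/- Fix \tau \in [0,1) and define, for z > 0, \Psi_s(z;\tau) := \sqrt{(1+\tau)/((1-\tau) \cdot 2\pi)} \cdot (2/\sqrt{\pi}) \int_0^{\infty} \log( 1 - (1-z) e^{-t^2} ) \, dt, and for x > 0, \phi_s(x;\tau) := \sup_{u \in \mathbb{R}} \{ (x/2) u - \Psi_s(e^u;\tau) \}. Then \phi_s(\cdot;\tau) attains a strict global minimum on (0,\infty) at x_s := \sqrt{(2/\pi) \cdot (1+\tau)/(1-\tau)}, with \phi_s(x_s;\tau) = 0 and \phi_s(x;\tau) > 0 for every x > 0 with x \ne x_s. -/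
open Real Set MeasureTheory Filter

/-- `Ψ_s(z;τ) = √((1+τ)/((1-τ)·2π)) · (2/√π) ∫_0^∞ log(1 - (1-z) e^{-t²}) dt`. -/
noncomputable def PsiS (τ z : ℝ) : ℝ :=
  Real.sqrt ((1 + τ) / ((1 - τ) * (2 * Real.pi))) *
    ((2 / Real.sqrt Real.pi) *
      ∫ t in Set.Ioi (0 : ℝ), Real.log (1 - (1 - z) * Real.exp (-t ^ 2)))

/-- `φ_s(x;τ) = sup_{u ∈ ℝ} { (x/2) u - Ψ_s(e^u;τ) }`. -/
noncomputable def phiS (τ x : ℝ) : ℝ :=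
  ⨆ u : ℝ, ((x / 2) * u - PsiS τ (Real.exp u))

lemma one_sub_one_sub_exp_mul_exp_pos (u t : ℝ) :
    0 < 1 - (1 - exp u) * exp (-t ^ 2) := by
  have h1 : exp (-t ^ 2) ≤ 1 := exp_le_one_iff.2 (by nlinarith [sq_nonneg t])
  nlinarith [mul_pos (exp_pos u) (exp_pos (-t ^ 2))]

/-- Weighted AM-GM: `e^{pu} ≤ 1 - p + p e^u` with `p = e^{-t²}`. -/
lemma mul_exp_neg_sq_le_log (u t : ℝ) :
    u * exp (-t ^ 2) ≤ log (1 - (1 - exp u) * exp (-t ^ 2)) := by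
  rw [le_log_iff_exp_le (one_sub_one_sub_exp_mul_exp_pos u t)]
  have h1 : exp (-t ^ 2) ≤ 1 := exp_le_one_iff.2 (by nlinarith [sq_nonneg t])
  have h := convexOn_exp.2 (mem_univ (0 : ℝ)) (mem_univ u)
    (sub_nonneg.2 h1) (exp_pos (-t ^ 2)).le (by ring)
  simp only [smul_eq_mul, mul_zero, zero_add, exp_zero, mul_one] at h
  rw [mul_comm u]
  linarith

lemma log_le_mul_exp_neg_sq (u t : ℝ) :
    log (1 - (1 - exp u) * exp (-t ^ 2)) ≤ (exp u - 1) * exp (-t ^ 2) := by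
  linarith [log_le_sub_one_of_pos (one_sub_one_sub_exp_mul_exp_pos u t)]

lemma integrable_exp_neg_sq : Integrable (fun t : ℝ => exp (-t ^ 2)) := by
  simpa using integrable_exp_neg_mul_sq (b := 1) one_pos

lemma integral_Ioi_exp_neg_sq : ∫ t in Ioi (0 : ℝ), exp (-t ^ 2) = √π / 2 := by
  simpa using integral_gaussian_Ioi 1

lemma integrable_log_one_sub_exp (u : ℝ) :
    Integrable (fun t : ℝ => log (1 - (1 - exp u) * exp (-t ^ 2))) := by
  refine (integrable_exp_neg_sq.const_mul (|u| + |exp u - 1|)).mono' ?_ ?_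
  · exact (Continuous.log (by fun_prop)
      fun t => (one_sub_one_sub_exp_mul_exp_pos u t).ne').aestronglyMeasurable
  · refine Eventually.of_forall fun t => ?_
    have hp := exp_pos (-t ^ 2)
    rw [norm_eq_abs, abs_le]
    constructor
    · nlinarith [mul_exp_neg_sq_le_log u t, neg_abs_le u, abs_nonneg (exp u - 1)]
    · nlinarith [log_le_mul_exp_neg_sq u t, le_abs_self (exp u - 1), abs_nonneg u]

lemma mul_le_integral_log (u : ℝ) :
    u * (√π / 2) ≤ ∫ t in Ioi (0 : ℝ), log (1 - (1 - exp u) * exp (-t ^ 2)) := by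
  rw [← integral_Ioi_exp_neg_sq, ← integral_const_mul]
  exact integral_mono (integrable_exp_neg_sq.const_mul u).integrableOn
    (integrable_log_one_sub_exp u).integrableOn (mul_exp_neg_sq_le_log u)

lemma integral_log_le_mul (u : ℝ) :
    ∫ t in Ioi (0 : ℝ), log (1 - (1 - exp u) * exp (-t ^ 2)) ≤ (exp u - 1) * (√π / 2) := by
  rw [← integral_Ioi_exp_neg_sq, ← integral_const_mul]
  exact integral_mono (integrable_log_one_sub_exp u).integrableOn
    (integrable_exp_neg_sq.const_mul _).integrableOn (log_le_mul_exp_neg_sq u)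

/-- Superlinear growth of the integral as `u → ∞`. -/
lemma mul_sub_le_integral_log {u T : ℝ} (hu : 0 ≤ u) (hT : 0 ≤ T) :
    u * T - T ^ 3 / 3 ≤ ∫ t in Ioi (0 : ℝ), log (1 - (1 - exp u) * exp (-t ^ 2)) := by
  have h1 : u * T - T ^ 3 / 3 = ∫ t in Ioc 0 T, (u - t ^ 2) := by
    rw [← intervalIntegral.integral_of_le hT, intervalIntegral.integral_sub (by simp)
      ((by fun_prop : Continuous fun t : ℝ => t ^ 2).intervalIntegrable _ _)]
    simp
    ring
  have h2 : ∫ t in Ioc 0 T, (u - t ^ 2) ≤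
      ∫ t in Ioc 0 T, log (1 - (1 - exp u) * exp (-t ^ 2)) := by
    refine integral_mono ((by fun_prop : Continuous fun t : ℝ => u - t ^ 2).integrableOn_Ioc)
      (integrable_log_one_sub_exp u).integrableOn fun t => ?_
    refine (le_log_iff_exp_le (one_sub_one_sub_exp_mul_exp_pos u t)).2 ?_
    have h : exp (-t ^ 2) ≤ 1 := exp_le_one_iff.2 (by nlinarith [sq_nonneg t])
    rw [sub_eq_add_neg, exp_add]
    linarith
  rw [h1]
  refine h2.trans (setIntegral_mono_set (integrable_log_one_sub_exp u).integrableOn ?_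
    Ioc_subset_Ioi_self.eventuallyLE)
  exact Eventually.of_forall fun t =>
    (mul_nonneg hu (exp_pos _).le).trans (mul_exp_neg_sq_le_log u t)

/-- The integral is bounded below, uniformly in `u`. -/
lemma exists_le_integral_log :
    ∃ K : ℝ, ∀ u : ℝ, K ≤ ∫ t in Ioi (0 : ℝ), log (1 - (1 - exp u) * exp (-t ^ 2)) := by
  refine ⟨(∫ t in Ioc (0 : ℝ) 1, (2 * log t - 1)) + ∫ t in Ioi (1 : ℝ), -2 * exp (-t ^ 2),
    fun u => ?_⟩
  have hint := integrable_log_one_sub_exp u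
  rw [← Ioc_union_Ioi_eq_Ioi zero_le_one, setIntegral_union Ioc_disjoint_Ioi_same
    measurableSet_Ioi hint.integrableOn hint.integrableOn]
  have hlog : IntegrableOn log (Ioc (0 : ℝ) 1) :=
    (intervalIntegrable_iff_integrableOn_Ioc_of_le zero_le_one).1
      intervalIntegral.intervalIntegrable_log'
  have hsub (t : ℝ) : 1 - exp (-t ^ 2) ≤ 1 - (1 - exp u) * exp (-t ^ 2) := by
    linarith [mul_pos (exp_pos u) (exp_pos (-t ^ 2))]
  gcongr ?_ + ?_
  · refine setIntegral_mono_on ((hlog.const_mul 2).sub (by simp)) hint.integrableOn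
      measurableSet_Ioc fun t ht => ?_
    have ht0 : 0 < t := ht.1
    have hmul : t ^ 2 * exp (-t ^ 2) ≤ 1 - exp (-t ^ 2) := by
      have h := mul_le_mul_of_nonneg_right (add_one_le_exp (t ^ 2)) (exp_pos (-t ^ 2)).le
      rw [← exp_add, add_neg_cancel, exp_zero] at h
      linarith
    have h := log_le_log (by positivity) (hmul.trans (hsub t))
    rw [log_mul (by positivity) (exp_pos _).ne', log_exp, log_pow] at h
    push_cast at h
    nlinarith [ht.2]
  · refine setIntegral_mono_on (integrable_exp_neg_sq.const_mul _).integrableOn hint.integrableOn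
      measurableSet_Ioi fun t ht => ?_
    have ht1 : 1 < t := ht
    have hp : exp (-t ^ 2) ≤ 1 / 2 := by
      rw [exp_neg, one_div]
      exact inv_anti₀ two_pos (by nlinarith [add_one_le_exp (t ^ 2)])
    have hq : 0 < 1 - exp (-t ^ 2) := by linarith
    refine le_trans ?_ (log_le_log hq (hsub t))
    refine le_trans ?_ (one_sub_inv_le_log_of_pos hq)
    have hinv : (1 - exp (-t ^ 2))⁻¹ ≤ 1 + 2 * exp (-t ^ 2) := by
      rw [inv_le_iff_one_le_mul₀ hq]
      nlinarith [exp_pos (-t ^ 2)]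
    linarith

lemma bddAbove_mul_sub_integral_log {a b : ℝ} (ha : 0 ≤ a) (hb : 0 < b) :
    BddAbove (range fun u : ℝ =>
      a * u - b * ∫ t in Ioi (0 : ℝ), log (1 - (1 - exp u) * exp (-t ^ 2))) := by
  obtain ⟨K, hK⟩ := exists_le_integral_log
  refine ⟨max (-(b * K)) (b * ((a / b) ^ 3 / 3)), ?_⟩
  rintro _ ⟨u, rfl⟩
  rcases le_total u 0 with hu | hu
  · refine le_max_of_le_left ?_
    have := mul_le_mul_of_nonneg_left (hK u) hb.le
    dsimp only
    linarith [mul_nonpos_of_nonneg_of_nonpos ha hu]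
  · refine le_max_of_le_right ?_
    have h := mul_le_mul_of_nonneg_left (mul_sub_le_integral_log hu (div_nonneg ha hb.le)) hb.le
    rw [mul_sub, show b * (u * (a / b)) = a * u by field_simp] at h
    dsimp only
    linarith

/-- **Minimiser of the strong-asymmetry rate function.** For `τ ∈ [0,1)`, the function
`φ_s(·;τ)` attains a strict global minimum on `(0,∞)` at
`x_s = √((2/π)·(1+τ)/(1-τ))`, with `φ_s(x_s;τ) = 0` and `φ_s(x;τ) > 0` for `x > 0`,
`x ≠ x_s`. -/
theorem phiS_strict_global_min (τ : ℝ) (hτ0 : 0 ≤ τ) (hτ1 : τ < 1) :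
    0 < Real.sqrt ((2 / π) * ((1 + τ) / (1 - τ))) ∧
    phiS τ (Real.sqrt ((2 / π) * ((1 + τ) / (1 - τ)))) = 0 ∧
    ∀ x : ℝ, 0 < x → x ≠ Real.sqrt ((2 / π) * ((1 + τ) / (1 - τ))) → 0 < phiS τ x := by
  have hτ : 0 < (1 + τ) / (1 - τ) := div_pos (by linarith) (by linarith)
  set c := √((1 + τ) / ((1 - τ) * (2 * π))) with hc
  have hxs : √((2 / π) * ((1 + τ) / (1 - τ))) = 2 * c := by
    have h1 : (1 - τ) ≠ 0 := by linarith
    have hpi := pi_pos.ne'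
    rw [hc, show (2 / π) * ((1 + τ) / (1 - τ)) = 2 ^ 2 * ((1 + τ) / ((1 - τ) * (2 * π))) by
      field_simp, sqrt_mul (by positivity), sqrt_sq zero_le_two]
  have hc0 : 0 < c := sqrt_pos.2 (div_pos (by linarith)
    (mul_pos (by linarith) (by positivity)))
  have hpi : 0 < √π := sqrt_pos.2 pi_pos
  have hb : 0 < c * (2 / √π) := by positivity
  have hcancel (y : ℝ) : c * (2 / √π) * (y * (√π / 2)) = c * y := by field_simp
  have hPsi (u : ℝ) : PsiS τ (exp u) =
      c * (2 / √π) * ∫ t in Ioi (0 : ℝ), log (1 - (1 - exp u) * exp (-t ^ 2)) := by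
    rw [PsiS, mul_assoc]
  have hlower (u : ℝ) : c * u ≤ PsiS τ (exp u) := by
    rw [hPsi, ← hcancel]
    exact mul_le_mul_of_nonneg_left (mul_le_integral_log u) hb.le
  have hupper (u : ℝ) : PsiS τ (exp u) ≤ c * (exp u - 1) := by
    rw [hPsi, ← hcancel (exp u - 1)]
    exact mul_le_mul_of_nonneg_left (integral_log_le_mul u) hb.le
  have hbdd (x : ℝ) (hx : 0 < x) :
      BddAbove (range fun u : ℝ => (x / 2) * u - PsiS τ (exp u)) := by
    simp only [hPsi]
    exact bddAbove_mul_sub_integral_log (by positivity) hb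
  rw [hxs]
  refine ⟨by positivity, le_antisymm ?_ ?_, fun x hx hne => ?_⟩
  · refine ciSup_le fun u => ?_
    linarith [hlower u]
  · refine le_ciSup_of_le (hbdd _ (by positivity)) 0 ?_
    have := hupper 0
    simp only [exp_zero, sub_self, mul_zero] at this ⊢
    linarith
  · set u := log (x / 2 / c) with hu
    refine lt_of_lt_of_le ?_ (le_ciSup (hbdd x hx) u)
    have hexp : c * exp u = x / 2 := by
      rw [hu, exp_log (by positivity)]
      field_simp
    have hu0 : -u ≠ 0 := fun h => hne (by
      rw [neg_eq_zero.1 h, exp_zero] at hexp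
      linarith)
    have hstrict : 1 - u < exp (-u) := by linarith [add_one_lt_exp hu0]
    have hinv : (x / 2) * exp (-u) = c := by
      rw [← hexp, mul_assoc, ← exp_add, add_neg_cancel, exp_zero, mul_one]
    have := mul_lt_mul_of_pos_left hstrict (half_pos hx)
    linarith [hupper u]
end

section
/- Fix \alpha > 0 and define, for z > 0, \Psi_w(z;\alpha) := (2/\pi) \int_0^1 \log( 1 - (1-z) e^{-\alpha^2 s^2} ) \sqrt{1-s^2} \, ds, and for x > 0, \phi_w(x;\alpha) := \sup_{u \in \mathbb{R}} \{ (x/2) u - \Psi_w(e^u;\alpha) \}. Then \phi_w(\cdot;\alpha) attains a strict global minimum on (0,1) at x_w := c(\alpha) := (4/\pi) \int_0^1 e^{-\alpha^2 s^2} \sqrt{1-s^2} \, ds, with \phi_w(x_w;\alpha) = 0 and \phi_w(x;\alpha) > 0 for every x \in (0,1) with x \ne x_w. -/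
open Real Set MeasureTheory Filter

/-- `Ψ_w(z;α) = (2/π) ∫_0^1 log(1 - (1-z) e^{-α²s²}) √(1-s²) ds`. -/
noncomputable def PsiW (α z : ℝ) : ℝ :=
  (2 / Real.pi) *
    ∫ s in (0:ℝ)..1, Real.log (1 - (1 - z) * Real.exp (-α ^ 2 * s ^ 2)) * Real.sqrt (1 - s ^ 2)

/-- `φ_w(x;α) = sup_{u ∈ ℝ} { (x/2) u - Ψ_w(e^u;α) }`. -/
noncomputable def phiW (α x : ℝ) : ℝ :=
  ⨆ u : ℝ, ((x / 2) * u - PsiW α (Real.exp u))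

/-- `c(α) = (4/π) ∫_0^1 e^{-α²s²} √(1-s²) ds`. -/
noncomputable def cFun (α : ℝ) : ℝ :=
  (4 / Real.pi) * ∫ s in (0:ℝ)..1, Real.exp (-α ^ 2 * s ^ 2) * Real.sqrt (1 - s ^ 2)

lemma continuous_gaussian_mul_semicircle (α : ℝ) :
    Continuous fun s : ℝ => Real.exp (-α ^ 2 * s ^ 2) * Real.sqrt (1 - s ^ 2) := by
  fun_prop

lemma integral_sqrt_one_sub_sq_zero_one :
    ∫ s in (0:ℝ)..1, Real.sqrt (1 - s ^ 2) = Real.pi / 4 := by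
  have hc : Continuous fun s : ℝ => Real.sqrt (1 - s ^ 2) := by fun_prop
  have h := intervalIntegral.integral_add_adjacent_intervals
    (hc.intervalIntegrable (μ := volume) (-1) 0) (hc.intervalIntegrable 0 1)
  rw [integral_sqrt_one_sub_sq] at h
  have hneg := intervalIntegral.integral_comp_neg (a := 0) (b := 1)
    (fun s : ℝ => Real.sqrt (1 - s ^ 2))
  simp only [neg_sq, neg_zero] at hneg
  linarith

lemma gaussian_le_one (α s : ℝ) : Real.exp (-α ^ 2 * s ^ 2) ≤ 1 :=
  Real.exp_le_one_iff.2 (by nlinarith [mul_nonneg (sq_nonneg α) (sq_nonneg s)])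

lemma logArg_pos (α s u : ℝ) : 0 < 1 - (1 - Real.exp u) * Real.exp (-α ^ 2 * s ^ 2) := by
  nlinarith [gaussian_le_one α s, mul_pos (Real.exp_pos u) (Real.exp_pos (-α ^ 2 * s ^ 2))]

lemma continuous_PsiW_integrand (α u : ℝ) :
    Continuous fun s : ℝ =>
      Real.log (1 - (1 - Real.exp u) * Real.exp (-α ^ 2 * s ^ 2)) * Real.sqrt (1 - s ^ 2) := by
  refine Continuous.mul (Continuous.log (by fun_prop) fun s => (logArg_pos α s u).ne') ?_
  fun_prop

/-- A pointwise lower bound on the logarithm integrates to a lower bound on `PsiW`. -/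
lemma le_PsiW_of_le_log {α u : ℝ} {f : ℝ → ℝ}
    (hf : IntervalIntegrable (fun s => f s * Real.sqrt (1 - s ^ 2)) volume 0 1)
    (h : ∀ s ∈ Set.Ioo (0:ℝ) 1,
      f s ≤ Real.log (1 - (1 - Real.exp u) * Real.exp (-α ^ 2 * s ^ 2))) :
    (2 / Real.pi) * ∫ s in (0:ℝ)..1, f s * Real.sqrt (1 - s ^ 2) ≤ PsiW α (Real.exp u) := by
  refine mul_le_mul_of_nonneg_left ?_ (by positivity)
  refine intervalIntegral.integral_mono_on_of_le_Ioo zero_le_one hf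
    ((continuous_PsiW_integrand α u).intervalIntegrable _ _) fun s hs => ?_
  exact mul_le_mul_of_nonneg_right (h s hs) (Real.sqrt_nonneg _)

/-- Concavity of the logarithm: `Ψ_w(e^u) ≥ c(α) u / 2`. -/
lemma cFun_mul_le_PsiW (α u : ℝ) : cFun α / 2 * u ≤ PsiW α (Real.exp u) := by
  have h := le_PsiW_of_le_log (α := α) (u := u) (f := fun s => u * Real.exp (-α ^ 2 * s ^ 2))
    (Continuous.intervalIntegrable (by fun_prop) _ _) fun s _ => by
      rw [Real.le_log_iff_exp_le (logArg_pos α s u)]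
      have hg := gaussian_le_one α s
      have hconv := convexOn_exp.2 (Set.mem_univ 0) (Set.mem_univ u)
        (sub_nonneg.2 hg) (Real.exp_pos (-α ^ 2 * s ^ 2)).le (by ring)
      simp only [smul_eq_mul, mul_zero, zero_add, Real.exp_zero] at hconv
      rw [mul_comm u]
      linarith
  simp only [mul_assoc u, intervalIntegral.integral_const_mul] at h
  refine le_of_eq_of_le ?_ h
  unfold cFun
  ring

/-- The bound `log y ≤ y - 1` integrates to `Ψ_w(e^u) ≤ c(α) (e^u - 1) / 2`. -/
lemma PsiW_le_cFun_mul (α u : ℝ) : PsiW α (Real.exp u) ≤ cFun α / 2 * (Real.exp u - 1) := by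
  have h : ∫ s in (0:ℝ)..1,
        Real.log (1 - (1 - Real.exp u) * Real.exp (-α ^ 2 * s ^ 2)) * Real.sqrt (1 - s ^ 2) ≤
      ∫ s in (0:ℝ)..1, (Real.exp u - 1) * (Real.exp (-α ^ 2 * s ^ 2) * Real.sqrt (1 - s ^ 2)) := by
    refine intervalIntegral.integral_mono_on zero_le_one
      ((continuous_PsiW_integrand α u).intervalIntegrable _ _)
      (Continuous.intervalIntegrable (by fun_prop) _ _) fun s _ => ?_
    rw [← mul_assoc]
    refine mul_le_mul_of_nonneg_right ?_ (Real.sqrt_nonneg _)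
    linarith [Real.log_le_sub_one_of_pos (logArg_pos α s u)]
  rw [intervalIntegral.integral_const_mul] at h
  refine (mul_le_mul_of_nonneg_left h (by positivity : 0 ≤ 2 / Real.pi)).trans_eq ?_
  unfold cFun
  ring

/-- Dropping `1 - e^{-α²s²} ≥ 0` in the logarithm: `Ψ_w(e^u) ≥ (u - α²) / 2`. -/
lemma sub_sq_div_two_le_PsiW (α u : ℝ) : (u - α ^ 2) / 2 ≤ PsiW α (Real.exp u) := by
  have h := le_PsiW_of_le_log (α := α) (u := u) (f := fun _ => u - α ^ 2)
    (Continuous.intervalIntegrable (by fun_prop) _ _) fun s hs => by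
      rw [Real.le_log_iff_exp_le (logArg_pos α s u)]
      have hle : Real.exp (u - α ^ 2) ≤ Real.exp u * Real.exp (-α ^ 2 * s ^ 2) := by
        rw [← Real.exp_add, Real.exp_le_exp]
        nlinarith [mul_nonneg (sq_nonneg α) (by nlinarith [hs.1, hs.2] : 0 ≤ 1 - s ^ 2)]
      linarith [gaussian_le_one α s]
  rw [intervalIntegral.integral_const_mul, integral_sqrt_one_sub_sq_zero_one] at h
  refine le_of_eq_of_le ?_ h
  field_simp
  norm_num

/-- `Ψ_w(e^u)` is bounded below uniformly in `u`, since `log(1 - e^{-α²s²})` has only a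
logarithmic singularity at `0`. -/
lemma exists_le_PsiW {α : ℝ} (hα : 0 < α) : ∃ C, ∀ u, C ≤ PsiW α (Real.exp u) := by
  refine ⟨_, fun u => le_PsiW_of_le_log
    (f := fun s => Real.log (α ^ 2 / (1 + α ^ 2)) + 2 * Real.log s) ?_ fun s hs => ?_⟩
  · refine IntervalIntegrable.mul_continuousOn ?_ (by fun_prop)
    exact intervalIntegrable_const.add (intervalIntegral.intervalIntegrable_log'.const_mul 2)
  · have hs0 := hs.1
    rw [← Nat.cast_ofNat (R := ℝ), ← Real.log_pow, ← Real.log_mul (by positivity) (by positivity)]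
    refine Real.log_le_log (by positivity) ?_
    set t := α ^ 2 * s ^ 2 with ht
    have ht0 : 0 < t := by positivity
    have hexp : Real.exp (-α ^ 2 * s ^ 2) ≤ 1 / (1 + t) := by
      rw [neg_mul, Real.exp_neg, ← one_div]
      exact one_div_le_one_div_of_le (by positivity) (by linarith [Real.add_one_le_exp t])
    have hts : t ≤ α ^ 2 := mul_le_of_le_one_right (by positivity) (by nlinarith [hs.2])
    have hk : α ^ 2 / (1 + α ^ 2) * s ^ 2 ≤ 1 - 1 / (1 + t) := by
      calc α ^ 2 / (1 + α ^ 2) * s ^ 2 = t / (1 + α ^ 2) := by rw [ht]; ring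
        _ ≤ t / (1 + t) := div_le_div_of_nonneg_left ht0.le (by positivity) (by linarith)
        _ = 1 - 1 / (1 + t) := by field_simp; ring
    nlinarith [mul_pos (Real.exp_pos u) (Real.exp_pos (-α ^ 2 * s ^ 2))]

lemma bddAbove_range_phiW {α x : ℝ} (hα : 0 < α) (hx : x ∈ Set.Ioo (0:ℝ) 1) :
    BddAbove (Set.range fun u : ℝ => x / 2 * u - PsiW α (Real.exp u)) := by
  obtain ⟨C, hC⟩ := exists_le_PsiW hα
  refine ⟨max (α ^ 2 / 2) (-C), ?_⟩
  rintro _ ⟨u, rfl⟩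
  rcases le_total 0 u with hu | hu
  · refine le_max_of_le_left ?_
    nlinarith [sub_sq_div_two_le_PsiW α u, mul_nonneg hu (sub_nonneg.2 hx.2.le)]
  · refine le_max_of_le_right ?_
    nlinarith [hC u, mul_nonneg (neg_nonneg.2 hu) hx.1.le]

lemma cFun_mem_Ioo {α : ℝ} (hα : 0 < α) : cFun α ∈ Set.Ioo (0:ℝ) 1 := by
  have hc := continuous_gaussian_mul_semicircle α
  have hpi := Real.pi_pos
  constructor
  · refine mul_pos (by positivity) ?_
    refine intervalIntegral.intervalIntegral_pos_of_pos_on (hc.intervalIntegrable _ _)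
      (fun s hs => mul_pos (Real.exp_pos _) (Real.sqrt_pos.2 ?_)) zero_lt_one
    nlinarith [hs.1, hs.2]
  · have hlt : ∫ s in (0:ℝ)..1, Real.exp (-α ^ 2 * s ^ 2) * Real.sqrt (1 - s ^ 2) <
        ∫ s in (0:ℝ)..1, Real.sqrt (1 - s ^ 2) := by
      refine intervalIntegral.integral_lt_integral_of_continuousOn_of_le_of_exists_lt zero_lt_one
        hc.continuousOn (by fun_prop)
        (fun s _ => mul_le_of_le_one_left (Real.sqrt_nonneg _) (gaussian_le_one α s))
        ⟨1 / 2, by norm_num, ?_⟩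
      refine mul_lt_of_lt_one_left (Real.sqrt_pos.2 (by norm_num)) (Real.exp_lt_one_iff.2 ?_)
      nlinarith [pow_pos hα 2]
    rw [integral_sqrt_one_sub_sq_zero_one] at hlt
    calc cFun α < 4 / Real.pi * (Real.pi / 4) := mul_lt_mul_of_pos_left hlt (by positivity)
      _ = 1 := by field_simp

lemma phiW_cFun (α : ℝ) : phiW α (cFun α) = 0 := by
  have hle : ∀ u : ℝ, cFun α / 2 * u - PsiW α (Real.exp u) ≤ 0 := fun u =>
    sub_nonpos.2 (cFun_mul_le_PsiW α u)
  refine le_antisymm (ciSup_le hle) (le_ciSup_of_le ⟨0, Set.forall_mem_range.2 hle⟩ 0 ?_)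
  simp [PsiW]

lemma phiW_pos {α x : ℝ} (hα : 0 < α) (hx : x ∈ Set.Ioo (0:ℝ) 1) (hne : x ≠ cFun α) :
    0 < phiW α x := by
  have hc := (cFun_mem_Ioo hα).1
  have hx0 := hx.1
  refine lt_of_lt_of_le ?_ (le_ciSup (bddAbove_range_phiW hα hx) (Real.log (x / cFun α)))
  have hPsi := PsiW_le_cFun_mul α (Real.log (x / cFun α))
  have hlog : Real.log (cFun α / x) < cFun α / x - 1 :=
    Real.log_lt_sub_one_of_pos (by positivity) fun h => hne ((div_eq_one_iff_eq hx0.ne').1 h).symm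
  have hmul := mul_lt_mul_of_pos_left hlog hx0
  rw [← inv_div, Real.log_inv, inv_div, mul_sub, mul_div_cancel₀ _ hx0.ne'] at hmul
  have hval : cFun α / 2 * (Real.exp (Real.log (x / cFun α)) - 1) = (x - cFun α) / 2 := by
    rw [Real.exp_log (by positivity)]
    field_simp
  linarith

/-- **Minimiser of the weak-asymmetry rate function.** For `α > 0`, the function
`φ_w(·;α)` attains a strict global minimum on `(0,1)` at
`x_w = c(α) = (4/π) ∫_0^1 e^{-α²s²} √(1-s²) ds`, with `φ_w(x_w;α) = 0` and
`φ_w(x;α) > 0` for `x ∈ (0,1)`, `x ≠ x_w`. -/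
theorem phiW_strict_global_min (α : ℝ) (hα : 0 < α) :
    cFun α ∈ Set.Ioo (0 : ℝ) 1 ∧
    phiW α (cFun α) = 0 ∧
    ∀ x ∈ Set.Ioo (0 : ℝ) 1, x ≠ cFun α → 0 < phiW α x := by
  exact ⟨cFun_mem_Ioo hα, phiW_cFun α, fun _ hx hne => phiW_pos hα hx hne⟩
end

section
/- Fix \alpha > 0. The function \phi_w(\cdot;\alpha) is twice differentiable at its minimiser x_w := c(\alpha), and \phi_w''(x_w;\alpha) = 1 / \big( 2 ( c(\alpha) - c(\sqrt{2}\,\alpha) ) \big), where c(\beta) := (4/\pi) \int_0^1 e^{-\beta^2 s^2} \sqrt{1-s^2} \, ds. -/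
open Real Set MeasureTheory Filter

/-- Differentiation under an interval integral when the integrand and its derivative in the
parameter are jointly continuous. -/
theorem hasDerivAt_intervalIntegral_of_continuous {F F' : ℝ → ℝ → ℝ} {a b : ℝ}
    (hF : Continuous F.uncurry) (hF' : Continuous F'.uncurry)
    (h : ∀ u s, HasDerivAt (fun v => F v s) (F' u s) u) (u : ℝ) :
    HasDerivAt (fun v => ∫ s in a..b, F v s) (∫ s in a..b, F' u s) u := by
  have hFc : ∀ v, Continuous (F v) := fun v => hF.comp (by fun_prop : Continuous fun s => (v, s))
  have hFc' : ∀ v, Continuous (F' v) := fun v => hF'.comp (by fun_prop : Continuous fun s => (v, s))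
  obtain ⟨C, hC⟩ := ((isCompact_closedBall u 1).prod
    (isCompact_uIcc (a := a) (b := b))).exists_bound_of_continuousOn hF'.continuousOn
  refine (intervalIntegral.hasDerivAt_integral_of_dominated_loc_of_deriv_le
    (bound := fun _ => C) (Metric.closedBall_mem_nhds u one_pos)
    (Eventually.of_forall fun v => (hFc v).aestronglyMeasurable)
    ((hFc u).intervalIntegrable _ _) (hFc' u).aestronglyMeasurable
    (Eventually.of_forall fun s hs v hv => hC (v, s) ⟨hv, uIoc_subset_uIcc hs⟩)
    intervalIntegrable_const
    (Eventually.of_forall fun s _ v _ => h v s)).2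

/-- For a function with increasing derivative, a solution of `H a = x` attains the supremum
in the Legendre transform at `x`. -/
theorem iSup_mul_sub_eq_of_hasDerivAt {G H : ℝ → ℝ} (hG : ∀ u, HasDerivAt G (H u) u)
    (hH : Monotone H) (a : ℝ) : ⨆ u, (H a * u - G u) = H a * a - G a := by
  have hg : ∀ u, HasDerivAt (fun u => G u - H a * u) (H u - H a) u := fun u => by
    convert! (hG u).sub ((hasDerivAt_id u).const_mul (H a)) using 1
    simp
  have hconv : ConvexOn ℝ univ (fun u => G u - H a * u) := by
    refine Monotone.convexOn_univ_of_deriv (fun u => (hg u).differentiableAt) fun u v huv => ?_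
    rw [(hg u).deriv, (hg v).deriv]
    exact sub_le_sub_right (hH huv) _
  have hmin : IsMinOn (fun u => G u - H a * u) univ a := by
    refine hconv.isMinOn_of_leftDeriv_eq_zero (by simp) ?_
    rw [(hg a).hasDerivWithinAt.derivWithin (uniqueDiffWithinAt_Iio a), sub_self]
  have hle : ∀ u, H a * u - G u ≤ H a * a - G a := fun u => by
    have := isMinOn_univ_iff.mp hmin u
    linarith
  exact le_antisymm (ciSup_le hle)
    (le_ciSup (f := fun u => H a * u - G u) ⟨_, by rintro _ ⟨u, rfl⟩; exact hle u⟩ a)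

/-- The Legendre transform of a `C²` function with positive second derivative `K` is twice
differentiable at `H a`, with second derivative `(K a)⁻¹`. -/
theorem legendre_second_deriv {G H K : ℝ → ℝ} (hG : ∀ u, HasDerivAt G (H u) u)
    (hH : ∀ u, HasDerivAt H (K u) u) (hK : Continuous K) (hpos : ∀ u, 0 < K u) (a : ℝ) :
    ∃ v : ℝ → ℝ,
      (∀ᶠ y in nhds (H a), HasDerivAt (fun y => ⨆ u, (y * u - G u)) (v y) y) ∧
      HasDerivAt v (K a)⁻¹ (H a) := by
  have hmono : Monotone H :=
    (strictMono_of_deriv_pos fun u => by rw [(hH u).deriv]; exact hpos u).monotone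
  have hstrict : HasStrictDerivAt H (K a) a :=
    hasStrictDerivAt_of_hasDerivAt_of_continuousAt (Eventually.of_forall hH) hK.continuousAt
  have hs := hstrict.hasStrictFDerivAt_equiv (hpos a).ne'
  let R := hs.toOpenPartialHomeomorph H
  have ha : H a ∈ R.target := hs.image_mem_toOpenPartialHomeomorph_target
  have hsrc : a ∈ R.source := hs.mem_toOpenPartialHomeomorph_source
  have hderiv : ∀ y ∈ R.target, HasDerivAt R.symm (K (R.symm y))⁻¹ y := fun y hy =>
    R.hasDerivAt_symm hy (hpos _).ne' (hH _)
  have hright : ∀ y ∈ R.target, H (R.symm y) = y := fun y hy => R.right_inv hy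
  refine ⟨R.symm, ?_, ?_⟩
  · filter_upwards [R.open_target.mem_nhds ha] with y hy
    have heq : (fun y => ⨆ u, (y * u - G u)) =ᶠ[nhds y]
        fun y => y * R.symm y - G (R.symm y) := by
      filter_upwards [R.open_target.mem_nhds hy] with z hz
      have := iSup_mul_sub_eq_of_hasDerivAt hG hmono (R.symm z)
      rwa [hright z hz] at this
    refine HasDerivAt.congr_of_eventuallyEq ?_ heq
    have h1 := (hG (R.symm y)).comp y (hderiv y hy)
    rw [hright y hy] at h1
    convert! ((hasDerivAt_id y).mul (hderiv y hy)).sub h1 using 1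
    simp
  · have h := hderiv _ ha
    have hinv : R.symm (H a) = a := R.left_inv hsrc
    rwa [hinv] at h

/-- **Curvature of the weak-asymmetry rate function at its minimiser.** For `α > 0`,
the function `φ_w(·;α)` is twice differentiable at its minimiser `x_w = c(α)`, with
`φ_w''(x_w;α) = 1 / (2 (c(α) - c(√2 α)))`. -/
theorem phiW_second_deriv_at_min (α : ℝ) (hα : 0 < α) :
    ∃ φ' : ℝ → ℝ,
      (∀ᶠ x in nhds (cFun α), HasDerivAt (phiW α) (φ' x) x) ∧
      HasDerivAt φ' (1 / (2 * (cFun α - cFun (Real.sqrt 2 * α)))) (cFun α) := by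
  set E : ℝ → ℝ := fun s => exp (-α ^ 2 * s ^ 2) with hE
  set w : ℝ → ℝ := fun s => √(1 - s ^ 2) with hw
  have hEc : Continuous E := by fun_prop
  have hwc : Continuous w := by fun_prop
  have hE0 : ∀ s, 0 < E s := fun s => exp_pos _
  have hE1 : ∀ s, E s ≤ 1 := fun s => exp_le_one_iff.mpr (by
    nlinarith [mul_nonneg (sq_nonneg α) (sq_nonneg s)])
  set D : ℝ → ℝ → ℝ := fun u s => 1 - (1 - exp u) * E s with hD
  have hD0 : ∀ u s, 0 < D u s := fun u s => by
    have := mul_pos (exp_pos u) (hE0 s)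
    have := hE1 s
    simp only [hD]
    nlinarith
  have hDne : ∀ p : ℝ × ℝ, D p.1 p.2 ≠ 0 := fun p => (hD0 _ _).ne'
  have hDc : Continuous fun p : ℝ × ℝ => D p.1 p.2 := by fun_prop
  have hDd : ∀ u s, HasDerivAt (fun v => D v s) (exp u * E s) u := fun u s => by
    simpa using (((Real.hasDerivAt_exp u).const_sub 1).mul_const (E s)).const_sub 1
  let f0 : ℝ → ℝ → ℝ := fun u s => log (D u s) * w s
  let f1 : ℝ → ℝ → ℝ := fun u s => exp u * E s / D u s * w s
  let f2 : ℝ → ℝ → ℝ := fun u s => exp u * E s * (1 - E s) / D u s ^ 2 * w s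
  have hf0 : Continuous f0.uncurry := (hDc.log hDne).mul (by fun_prop)
  have hf1 : Continuous f1.uncurry :=
    (Continuous.div (by fun_prop) hDc hDne).mul (by fun_prop)
  have hf2 : Continuous f2.uncurry :=
    (Continuous.div (by fun_prop) (hDc.pow 2) fun p => pow_ne_zero 2 (hDne p)).mul (by fun_prop)
  have hd0 : ∀ u s, HasDerivAt (fun v => f0 v s) (f1 u s) u := fun u s =>
    ((hDd u s).log (hD0 u s).ne').mul_const (w s)
  have hd1 : ∀ u s, HasDerivAt (fun v => f1 v s) (f2 u s) u := fun u s => by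
    convert! (((Real.hasDerivAt_exp u).mul_const (E s)).div (hDd u s) (hD0 u s).ne').mul_const
      (w s) using 1
    simp only [f2, hD]
    ring
  have hpi : 0 < 2 / π := by positivity
  have hpos : ∀ u, 0 < 2 / π * ∫ s in (0:ℝ)..1, f2 u s := fun u => by
    refine mul_pos hpi (intervalIntegral.intervalIntegral_pos_of_pos_on
      (Continuous.intervalIntegrable
        (hf2.comp (by fun_prop : Continuous fun s => (u, s))) _ _) (fun s hs => ?_) one_pos)
    have hEs : E s < 1 := exp_lt_one_iff.mpr (by
      have := mul_pos (pow_pos hα 2) (pow_pos hs.1 2)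
      linarith)
    have hws : 0 < w s := sqrt_pos.mpr (by nlinarith [hs.1, hs.2])
    exact mul_pos (div_pos (mul_pos (mul_pos (exp_pos u) (hE0 s)) (sub_pos.mpr hEs))
      (pow_pos (hD0 u s) 2)) hws
  obtain ⟨v, hv1, hv2⟩ := legendre_second_deriv
    (fun u => (hasDerivAt_intervalIntegral_of_continuous (a := 0) (b := 1) hf0 hf1 hd0 u).const_mul
      (2 / π))
    (fun u => (hasDerivAt_intervalIntegral_of_continuous (a := 0) (b := 1) hf1 hf2 hd1 u).const_mul
      (2 / π))
    ((intervalIntegral.continuous_parametric_intervalIntegral_of_continuous' hf2 0 1).const_mul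
      (2 / π)) hpos 0
  have hH0 : 2 / π * ∫ s in (0:ℝ)..1, f1 0 s = cFun α / 2 := by
    simp only [f1, hD, cFun, exp_zero, sub_self, zero_mul, sub_zero, one_mul, div_one, hE, hw]
    ring
  have hK0 : 2 / π * ∫ s in (0:ℝ)..1, f2 0 s = (cFun α - cFun (√2 * α)) / 2 := by
    have hE2 : ∀ s, exp (-(√2 * α) ^ 2 * s ^ 2) = E s * E s := fun s => by
      rw [hE, ← Real.exp_add, mul_pow, Real.sq_sqrt zero_le_two]
      congr 1
      ring
    have hsub : ∫ s in (0:ℝ)..1, f2 0 s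
        = (∫ s in (0:ℝ)..1, E s * w s) - ∫ s in (0:ℝ)..1, E s * E s * w s := by
      rw [← intervalIntegral.integral_sub
        (Continuous.intervalIntegrable (by fun_prop) _ _)
        (Continuous.intervalIntegrable (by fun_prop) _ _)]
      refine intervalIntegral.integral_congr fun s _ => ?_
      simp only [f2, hD, exp_zero, sub_self, zero_mul, sub_zero, one_mul, one_pow, div_one]
      ring
    simp only [cFun, hE2]
    rw [hsub]
    ring
  rw [hH0] at hv1 hv2
  rw [hK0] at hv2
  have hphi : phiW α = fun x => (fun y => ⨆ u, (y * u - 2 / π * ∫ s in (0:ℝ)..1, f0 u s)) (x / 2) :=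
    rfl
  have hhalf : ∀ x : ℝ, HasDerivAt (fun x : ℝ => x / 2) (1 / 2) x := fun x =>
    (hasDerivAt_id x).div_const 2
  refine ⟨fun x => v (x / 2) * (1 / 2), ?_, ?_⟩
  · have ht : Tendsto (fun x : ℝ => x / 2) (nhds (cFun α)) (nhds (cFun α / 2)) :=
      (hhalf _).continuousAt
    filter_upwards [ht.eventually hv1] with x hx
    rw [hphi]
    exact hx.comp x (hhalf x)
  · convert! (hv2.comp (cFun α) (hhalf _)).mul_const (1 / 2) using 1
    rw [inv_div, one_div, mul_inv]
    ring
end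

section
/- Fix \alpha > 0. The function u \mapsto u/2 - \Psi_w(e^u;\alpha) is strictly increasing on \mathbb{R}; more precisely, its derivative satisfies, for every u \in \mathbb{R}, 1/2 - (2/\pi) \int_0^1 \frac{ e^{u - \alpha^2 s^2} }{ e^{u - \alpha^2 s^2} + 1 - e^{-\alpha^2 s^2} } \sqrt{1-s^2} \, ds > 0. -/
open Real Set MeasureTheory Filter

theorem integral_zero_one_sqrt_one_sub_sq :
    ∫ s in (0:ℝ)..1, Real.sqrt (1 - s ^ 2) = π / 4 := by
  have hii (a b : ℝ) : IntervalIntegrable (fun s : ℝ => Real.sqrt (1 - s ^ 2)) volume a b :=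
    Continuous.intervalIntegrable (by fun_prop) _ _
  have h := intervalIntegral.integral_add_adjacent_intervals (hii (-1) 0) (hii 0 1)
  have hneg := intervalIntegral.integral_comp_neg (a := 0) (b := 1)
    (fun s : ℝ => Real.sqrt (1 - s ^ 2))
  simp only [neg_sq, neg_zero] at hneg
  rw [integral_sqrt_one_sub_sq, ← hneg] at h
  linarith

theorem exp_sub_add_one_sub_exp_neg_pos (α u s : ℝ) :
    0 < Real.exp (u - α ^ 2 * s ^ 2) + 1 - Real.exp (-α ^ 2 * s ^ 2) := by
  have h : Real.exp (-α ^ 2 * s ^ 2) ≤ 1 := Real.exp_le_one_iff.2 (by nlinarith [sq_nonneg (α * s)])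
  linarith [Real.exp_pos (u - α ^ 2 * s ^ 2)]

theorem exp_sub_div_le_one (α u s : ℝ) :
    Real.exp (u - α ^ 2 * s ^ 2) /
      (Real.exp (u - α ^ 2 * s ^ 2) + 1 - Real.exp (-α ^ 2 * s ^ 2)) ≤ 1 := by
  have h : Real.exp (-α ^ 2 * s ^ 2) ≤ 1 := Real.exp_le_one_iff.2 (by nlinarith [sq_nonneg (α * s)])
  rw [div_le_one (exp_sub_add_one_sub_exp_neg_pos α u s)]
  linarith

theorem exp_sub_div_lt_one {α s : ℝ} (hα : 0 < α) (hs : 0 < s) (u : ℝ) :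
    Real.exp (u - α ^ 2 * s ^ 2) /
      (Real.exp (u - α ^ 2 * s ^ 2) + 1 - Real.exp (-α ^ 2 * s ^ 2)) < 1 := by
  have h : Real.exp (-α ^ 2 * s ^ 2) < 1 :=
    Real.exp_lt_one_iff.2 (by nlinarith [pow_pos (mul_pos hα hs) 2])
  rw [div_lt_one (exp_sub_add_one_sub_exp_neg_pos α u s)]
  linarith

theorem one_sub_one_sub_exp_mul_exp (α u s : ℝ) :
    1 - (1 - Real.exp u) * Real.exp (-α ^ 2 * s ^ 2) =
      Real.exp (u - α ^ 2 * s ^ 2) + 1 - Real.exp (-α ^ 2 * s ^ 2) := by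
  rw [show u - α ^ 2 * s ^ 2 = u + -α ^ 2 * s ^ 2 by ring, Real.exp_add]
  ring

theorem continuous_exp_sub_div_mul_sqrt (α u : ℝ) :
    Continuous fun s : ℝ => (Real.exp (u - α ^ 2 * s ^ 2) /
      (Real.exp (u - α ^ 2 * s ^ 2) + 1 - Real.exp (-α ^ 2 * s ^ 2))) * Real.sqrt (1 - s ^ 2) :=
  (Continuous.div (by fun_prop) (by fun_prop)
    fun s => (exp_sub_add_one_sub_exp_neg_pos α u s).ne').mul (by fun_prop)

theorem hasDerivAt_psiW_exp (α u : ℝ) :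
    HasDerivAt (fun u : ℝ => PsiW α (Real.exp u))
      ((2 / π) * ∫ s in (0:ℝ)..1, (Real.exp (u - α ^ 2 * s ^ 2) /
        (Real.exp (u - α ^ 2 * s ^ 2) + 1 - Real.exp (-α ^ 2 * s ^ 2))) *
          Real.sqrt (1 - s ^ 2)) u := by
  unfold PsiW
  simp_rw [one_sub_one_sub_exp_mul_exp]
  refine HasDerivAt.const_mul _ ?_
  have hcont (v : ℝ) : Continuous fun s : ℝ =>
      Real.log (Real.exp (v - α ^ 2 * s ^ 2) + 1 - Real.exp (-α ^ 2 * s ^ 2)) *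
        Real.sqrt (1 - s ^ 2) :=
    (Continuous.log (by fun_prop) fun s => (exp_sub_add_one_sub_exp_neg_pos α v s).ne').mul
      (by fun_prop)
  refine (intervalIntegral.hasDerivAt_integral_of_dominated_loc_of_deriv_le
    (s := univ) (bound := fun s => Real.sqrt (1 - s ^ 2))
    (F' := fun v s => (Real.exp (v - α ^ 2 * s ^ 2) /
      (Real.exp (v - α ^ 2 * s ^ 2) + 1 - Real.exp (-α ^ 2 * s ^ 2))) * Real.sqrt (1 - s ^ 2))
    univ_mem (.of_forall fun v => (hcont v).aestronglyMeasurable)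
    ((hcont u).intervalIntegrable _ _)
    (continuous_exp_sub_div_mul_sqrt α u).aestronglyMeasurable
    (.of_forall fun s _ v _ => ?_) (Continuous.intervalIntegrable (by fun_prop) _ _)
    (.of_forall fun s _ v _ => ?_)).2
  · have hpos := exp_sub_add_one_sub_exp_neg_pos α v s
    rw [Real.norm_of_nonneg (by positivity)]
    exact mul_le_of_le_one_left (Real.sqrt_nonneg _) (exp_sub_div_le_one α v s)
  · have h := ((((hasDerivAt_id v).sub_const (α ^ 2 * s ^ 2)).exp.add_const 1).sub_const
      (Real.exp (-α ^ 2 * s ^ 2))).log (exp_sub_add_one_sub_exp_neg_pos α v s).ne'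
    simpa using h.mul_const (Real.sqrt (1 - s ^ 2))

theorem integral_exp_sub_div_mul_sqrt_lt {α : ℝ} (hα : 0 < α) (u : ℝ) :
    ∫ s in (0:ℝ)..1, (Real.exp (u - α ^ 2 * s ^ 2) /
      (Real.exp (u - α ^ 2 * s ^ 2) + 1 - Real.exp (-α ^ 2 * s ^ 2))) *
        Real.sqrt (1 - s ^ 2) < π / 4 := by
  rw [← integral_zero_one_sqrt_one_sub_sq]
  refine intervalIntegral.integral_lt_integral_of_continuousOn_of_le_of_exists_lt one_pos
    (continuous_exp_sub_div_mul_sqrt α u).continuousOn (by fun_prop)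
    (fun s _ => mul_le_of_le_one_left (Real.sqrt_nonneg _) (exp_sub_div_le_one α u s))
    ⟨1 / 2, by norm_num, ?_⟩
  exact mul_lt_of_lt_one_left (Real.sqrt_pos.2 (by norm_num))
    (exp_sub_div_lt_one hα (by norm_num) u)

/-- **Strict monotonicity of `u ↦ u/2 - Ψ_w(e^u;α)`.** For `α > 0`, the function
`u ↦ u/2 - Ψ_w(e^u;α)` is strictly increasing on `ℝ`; more precisely, its derivative is
`1/2 - (2/π) ∫_0^1 e^{u-α²s²} / (e^{u-α²s²} + 1 - e^{-α²s²}) √(1-s²) ds`, which is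
positive for every `u ∈ ℝ`. -/
theorem strictMono_half_sub_psiW (α : ℝ) (hα : 0 < α) :
    StrictMono (fun u : ℝ => u / 2 - PsiW α (Real.exp u)) ∧
    ∀ u : ℝ,
      HasDerivAt (fun u : ℝ => u / 2 - PsiW α (Real.exp u))
        (1 / 2 - (2 / π) * ∫ s in (0:ℝ)..1,
          (Real.exp (u - α ^ 2 * s ^ 2) /
            (Real.exp (u - α ^ 2 * s ^ 2) + 1 - Real.exp (-α ^ 2 * s ^ 2))) *
              Real.sqrt (1 - s ^ 2)) u ∧
      0 < 1 / 2 - (2 / π) * ∫ s in (0:ℝ)..1,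
          (Real.exp (u - α ^ 2 * s ^ 2) /
            (Real.exp (u - α ^ 2 * s ^ 2) + 1 - Real.exp (-α ^ 2 * s ^ 2))) *
              Real.sqrt (1 - s ^ 2) := by
  have hderiv (u : ℝ) := ((hasDerivAt_id u).div_const 2).sub (hasDerivAt_psiW_exp α u)
  have hpos (u : ℝ) : 0 < 1 / 2 - (2 / π) * ∫ s in (0:ℝ)..1,
      (Real.exp (u - α ^ 2 * s ^ 2) /
        (Real.exp (u - α ^ 2 * s ^ 2) + 1 - Real.exp (-α ^ 2 * s ^ 2))) *
          Real.sqrt (1 - s ^ 2) := by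
    have h := mul_lt_mul_of_pos_left (integral_exp_sub_div_mul_sqrt_lt hα u)
      (show 0 < 2 / π by positivity)
    have hpi : 2 / π * (π / 4) = 1 / 2 := by field_simp; norm_num
    linarith
  exact ⟨strictMono_of_hasDerivAt_pos hderiv hpos, fun u => ⟨hderiv u, hpos u⟩⟩
end

section
/- For every fixed x > 0: \lim_{\alpha \to \infty} \alpha \cdot \Psi_w(x;\alpha) = (2/\pi) \int_0^{\infty} \log( 1 - (1-x) e^{-t^2} ) \, dt; in particular, for 0 < x < 2 this limit equals -(1/\sqrt{\pi}) \sum_{k=1}^{\infty} (1-x)^k / k^{3/2} = -(1/\sqrt{\pi}) \, \mathrm{Li}_{3/2}(1-x). -/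
open Real Set MeasureTheory Filter

/-- A logarithm is bounded by the distance of its argument to `1`, away from `0`. -/
theorem abs_log_le_inv_mul_abs_sub_one {c y : ℝ} (hc : 0 < c) (hc1 : c ≤ 1) (hy : c ≤ y) :
    |Real.log y| ≤ c⁻¹ * |y - 1| := by
  have hy0 : 0 < y := hc.trans_le hy
  have hci : 1 ≤ c⁻¹ := (one_le_inv₀ hc).2 hc1
  rcases le_total 1 y with h | h
  · rw [abs_of_nonneg (Real.log_nonneg h), abs_of_nonneg (sub_nonneg.2 h)]
    exact (Real.log_le_sub_one_of_pos hy0).trans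
      (le_mul_of_one_le_left (sub_nonneg.2 h) hci)
  · rw [abs_of_nonpos (Real.log_nonpos hy0.le h), abs_of_nonpos (sub_nonpos.2 h)]
    have h1 : -Real.log y ≤ y⁻¹ * (1 - y) := by
      have := Real.log_le_sub_one_of_pos (inv_pos.2 hy0)
      rw [Real.log_inv] at this
      rw [mul_sub, mul_one, inv_mul_cancel₀ hy0.ne']
      exact this
    have h2 : y⁻¹ * (1 - y) ≤ c⁻¹ * (1 - y) :=
      mul_le_mul_of_nonneg_right (inv_anti₀ hc hy) (sub_nonneg.2 h)
    linarith

theorem min_one_le_one_sub_mul_exp (x t : ℝ) :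
    min 1 x ≤ 1 - (1 - x) * Real.exp (-t ^ 2) := by
  have h0 := Real.exp_pos (-t ^ 2)
  have h1 : Real.exp (-t ^ 2) ≤ 1 := Real.exp_le_one_iff.2 (neg_nonpos.2 (sq_nonneg t))
  rcases le_total 1 x with h | h
  · rw [min_eq_left h]; nlinarith
  · rw [min_eq_right h]; nlinarith

theorem continuous_log_one_sub_mul_exp {x : ℝ} (hx : 0 < x) :
    Continuous fun t : ℝ => Real.log (1 - (1 - x) * Real.exp (-t ^ 2)) :=
  Continuous.log (by fun_prop) fun t =>
    ((lt_min one_pos hx).trans_le (min_one_le_one_sub_mul_exp x t)).ne'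

theorem integrable_log_one_sub_mul_exp {x : ℝ} (hx : 0 < x) :
    Integrable fun t : ℝ => Real.log (1 - (1 - x) * Real.exp (-t ^ 2)) := by
  have hG : Integrable fun t : ℝ => (min 1 x)⁻¹ * (|1 - x| * Real.exp (-t ^ 2)) := by
    simpa using ((integrable_exp_neg_mul_sq one_pos).const_mul |1 - x|).const_mul (min 1 x)⁻¹
  refine hG.mono' (continuous_log_one_sub_mul_exp hx).aestronglyMeasurable
    (Eventually.of_forall fun t => ?_)
  have h := abs_log_le_inv_mul_abs_sub_one (lt_min one_pos hx) (min_le_left 1 x)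
    (min_one_le_one_sub_mul_exp x t)
  have e : |1 - (1 - x) * Real.exp (-t ^ 2) - 1| = |1 - x| * Real.exp (-t ^ 2) := by
    rw [sub_sub_cancel_left, abs_neg, abs_mul, Real.abs_exp]
  rwa [e] at h

/-- Rescaling `t = α s`; the semicircle weight vanishes beyond `t = α`. -/
theorem mul_psiW_eq_integral_Ioi {α : ℝ} (hα : 0 < α) (x : ℝ) :
    α * PsiW α x = (2 / π) * ∫ t in Set.Ioi (0 : ℝ),
      Real.log (1 - (1 - x) * Real.exp (-t ^ 2)) * Real.sqrt (1 - (α⁻¹ * t) ^ 2) := by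
  have h := integral_comp_mul_left_Ioi
    (fun t : ℝ => Real.log (1 - (1 - x) * Real.exp (-t ^ 2)) * Real.sqrt (1 - (α⁻¹ * t) ^ 2))
    0 hα
  rw [mul_zero, smul_eq_mul] at h
  have h2 : ∫ t in Set.Ioi (0 : ℝ),
      Real.log (1 - (1 - x) * Real.exp (-t ^ 2)) * Real.sqrt (1 - (α⁻¹ * t) ^ 2) =
      α * ∫ s in Set.Ioi (0 : ℝ),
        Real.log (1 - (1 - x) * Real.exp (-α ^ 2 * s ^ 2)) * Real.sqrt (1 - s ^ 2) := by
    rw [← inv_mul_eq_iff_eq_mul₀ hα.ne', ← h]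
    refine setIntegral_congr_fun measurableSet_Ioi fun s _ => ?_
    simp only [inv_mul_cancel_left₀ hα.ne', mul_pow, neg_mul]
  have h3 : ∫ s in Set.Ioi (0 : ℝ),
      Real.log (1 - (1 - x) * Real.exp (-α ^ 2 * s ^ 2)) * Real.sqrt (1 - s ^ 2) =
      ∫ s in (0 : ℝ)..1,
        Real.log (1 - (1 - x) * Real.exp (-α ^ 2 * s ^ 2)) * Real.sqrt (1 - s ^ 2) := by
    rw [intervalIntegral.integral_of_le zero_le_one]
    refine setIntegral_eq_of_subset_of_forall_sdiff_eq_zero measurableSet_Ioi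
      Ioc_subset_Ioi_self fun s hs => ?_
    have hs1 : 1 < s := not_le.1 fun h => hs.2 ⟨hs.1, h⟩
    rw [Real.sqrt_eq_zero_of_nonpos (by nlinarith), mul_zero]
  rw [h2, h3, PsiW]
  ring

theorem tendsto_integral_log_mul_sqrt {x : ℝ} (hx : 0 < x) :
    Tendsto (fun α : ℝ => ∫ t in Set.Ioi (0 : ℝ),
      Real.log (1 - (1 - x) * Real.exp (-t ^ 2)) * Real.sqrt (1 - (α⁻¹ * t) ^ 2)) atTop
      (nhds (∫ t in Set.Ioi (0 : ℝ), Real.log (1 - (1 - x) * Real.exp (-t ^ 2)))) := by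
  refine tendsto_integral_filter_of_dominated_convergence
    (fun t => |Real.log (1 - (1 - x) * Real.exp (-t ^ 2))|)
    (Eventually.of_forall fun α => ?_)
    (Eventually.of_forall fun α => Eventually.of_forall fun t => ?_)
    (integrable_log_one_sub_mul_exp hx).abs.integrableOn
    (Eventually.of_forall fun t => ?_)
  · exact ((continuous_log_one_sub_mul_exp hx).mul (by fun_prop)).aestronglyMeasurable
  · rw [Real.norm_eq_abs, abs_mul, abs_of_nonneg (Real.sqrt_nonneg _)]
    refine mul_le_of_le_one_right (abs_nonneg _) (Real.sqrt_le_one.2 ?_)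
    linarith [sq_nonneg (α⁻¹ * t)]
  · have h : Tendsto (fun α : ℝ => Real.sqrt (1 - (α⁻¹ * t) ^ 2)) atTop
        (nhds (Real.sqrt (1 - (0 * t) ^ 2))) :=
      ((tendsto_const_nhds.sub ((tendsto_inv_atTop_zero.mul_const t).pow 2))).sqrt
    simpa using h.const_mul (Real.log (1 - (1 - x) * Real.exp (-t ^ 2)))

theorem integral_Ioi_exp_neg_sq_pow (k : ℕ) :
    ∫ t in Set.Ioi (0 : ℝ), Real.exp (-t ^ 2) ^ (k + 1) = Real.sqrt (π / (k + 1)) / 2 := by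
  rw [← integral_gaussian_Ioi]
  congr 1 with t
  rw [← Real.exp_nat_mul]
  push_cast
  ring_nf

theorem integrable_exp_neg_sq_pow (k : ℕ) :
    Integrable fun t : ℝ => Real.exp (-t ^ 2) ^ (k + 1) := by
  refine (integrable_exp_neg_mul_sq (b := (k : ℝ) + 1) (by positivity)).congr
    (Eventually.of_forall fun t => ?_)
  simp only
  rw [← Real.exp_nat_mul]
  push_cast
  ring_nf

/-- Termwise integration of the Mercator series of `log (1 - w e^{-t²})`. -/
theorem integral_Ioi_log_one_sub_mul_exp {w : ℝ} (hw : |w| < 1) :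
    ∫ t in Set.Ioi (0 : ℝ), Real.log (1 - w * Real.exp (-t ^ 2)) =
      -∑' k : ℕ, w ^ (k + 1) / (k + 1) * (Real.sqrt (π / (k + 1)) / 2) := by
  set F : ℕ → ℝ → ℝ := fun k t => w ^ (k + 1) / (k + 1) * Real.exp (-t ^ 2) ^ (k + 1) with hF
  have hint (k : ℕ) : Integrable (F k) (volume.restrict (Set.Ioi 0)) :=
    ((integrable_exp_neg_sq_pow k).const_mul _).integrableOn
  have hval (k : ℕ) : ∫ t in Set.Ioi (0 : ℝ), F k t =
      w ^ (k + 1) / (k + 1) * (Real.sqrt (π / (k + 1)) / 2) := by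
    rw [← integral_Ioi_exp_neg_sq_pow, ← integral_const_mul]
  have hnorm (k : ℕ) : ∫ t in Set.Ioi (0 : ℝ), ‖F k t‖ =
      |w| ^ (k + 1) / (k + 1) * (Real.sqrt (π / (k + 1)) / 2) := by
    rw [← integral_Ioi_exp_neg_sq_pow, ← integral_const_mul]
    congr 1 with t
    have hk : (0 : ℝ) < k + 1 := by positivity
    simp only [hF, Real.norm_eq_abs, abs_mul, abs_div, abs_pow, Real.abs_exp, abs_of_pos hk]
  have hsum : Summable fun k => ∫ t in Set.Ioi (0 : ℝ), ‖F k t‖ := by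
    simp only [hnorm]
    refine Summable.of_nonneg_of_le (fun k => by positivity) (fun k => ?_)
      (((summable_geometric_of_lt_one (abs_nonneg w) hw).mul_left |w|).mul_right
        (Real.sqrt π / 2))
    have hk : (1 : ℝ) ≤ k + 1 := by linarith [k.cast_nonneg (α := ℝ)]
    rw [← pow_succ']
    gcongr
    · exact div_le_self (by positivity) hk
    · exact div_le_self pi_pos.le hk
  have key := integral_tsum_of_summable_integral_norm hint hsum
  simp only [hval] at key
  rw [key, ← integral_neg]
  congr 1 with t
  have he : Real.exp (-t ^ 2) ≤ 1 := Real.exp_le_one_iff.2 (neg_nonpos.2 (sq_nonneg t))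
  have hwt : |w * Real.exp (-t ^ 2)| < 1 := by
    rw [abs_mul, Real.abs_exp]
    exact (mul_le_of_le_one_right (abs_nonneg w) he).trans_lt hw
  have hs := (Real.hasSum_pow_div_log_of_abs_lt_one hwt).tsum_eq
  rw [eq_neg_iff_add_eq_zero, ← neg_eq_iff_add_eq_zero, ← hs]
  refine tsum_congr fun k => ?_
  simp only [hF, mul_pow]
  ring

/-- **Strong-asymmetry limit of `Ψ_w`.** For every fixed `x > 0`,
`α · Ψ_w(x;α) → (2/π) ∫_0^∞ log(1-(1-x)e^{-t²}) dt` as `α → ∞`; for `0 < x < 2` this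
limit equals `-(1/√π) ∑_{k≥1} (1-x)^k/k^{3/2} = -(1/√π) Li_{3/2}(1-x)`. -/
theorem alpha_mul_psiW_tendsto (x : ℝ) (hx : 0 < x) :
    Tendsto (fun α : ℝ => α * PsiW α x) atTop
      (nhds ((2 / π) * ∫ t in Set.Ioi (0 : ℝ),
        Real.log (1 - (1 - x) * Real.exp (-t ^ 2)))) ∧
    (x < 2 →
      (2 / π) * (∫ t in Set.Ioi (0 : ℝ), Real.log (1 - (1 - x) * Real.exp (-t ^ 2))) =
        -(1 / Real.sqrt π) * ∑' k : ℕ, (1 - x) ^ (k + 1) / (((k : ℝ) + 1) ^ ((3 : ℝ) / 2))) := by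
  refine ⟨?_, fun hx2 => ?_⟩
  · refine ((tendsto_integral_log_mul_sqrt hx).const_mul (2 / π)).congr' ?_
    filter_upwards [eventually_gt_atTop 0] with α hα
    exact (mul_psiW_eq_integral_Ioi hα x).symm
  · have hw : |1 - x| < 1 := abs_lt.2 ⟨by linarith, by linarith⟩
    rw [integral_Ioi_log_one_sub_mul_exp hw, mul_neg, neg_mul, ← tsum_mul_left, ← tsum_mul_left]
    congr 1
    refine tsum_congr fun k => ?_
    have hk : (0 : ℝ) < k + 1 := by positivity
    have hpow : ((k : ℝ) + 1) ^ ((3 : ℝ) / 2) = (k + 1) * Real.sqrt (k + 1) := by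
      rw [Real.sqrt_eq_rpow, show (3 : ℝ) / 2 = 1 + 1 / 2 by norm_num, Real.rpow_add hk,
        Real.rpow_one]
    have hπ : Real.sqrt π * Real.sqrt π = π := Real.mul_self_sqrt pi_pos.le
    have hsk : 0 < Real.sqrt ((k : ℝ) + 1) := Real.sqrt_pos.2 hk
    have hsπ : 0 < Real.sqrt π := Real.sqrt_pos.2 pi_pos
    have hc : 2 / π * (Real.sqrt π / 2) = 1 / Real.sqrt π := by
      field_simp
      linarith
    rw [hpow, Real.sqrt_div pi_pos.le, ← hc]
    field_simp
end
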